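/- Let n ≥ 3 and let 0 < a < 1/(n-2). Then for every v ∈ C_c^∞(B_1), ∫_{B_1} |x|^{-(n-2)} |∇v|² dx ≥ a^{2(n-1)/n} S_n · ( ∫_{B_1} |x|^{-n} X_1(a,|x|)^{2(n-1)/(n-2)} |v|^{2n/(n-2)} dx )^{(n-2)/n}. -/

import Mathlib

open MeasureTheory Real

/-- The best Sobolev constant `S_n = π n (n-2) (Γ(n/2)/Γ(n))^(2/n)`. -/
noncomputable def sobolevConst (n : ℕ) : ℝ :=
  Real.pi * n * ((n : ℝ) - 2) * (Real.Gamma ((n : ℝ) / 2) / Real.Gamma (n : ℝ)) ^ (2 / (n : ℝ))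

/-- `X_1(a,s) = (a - ln s)⁻¹`. -/
noncomputable def X1 (a s : ℝ) : ℝ := (a - Real.log s)⁻¹

section

/-- A continuous, positive and integrable function on the line. -/
structure PosDensity (p : ℝ → ℝ) : Prop where
  continuous : Continuous p
  pos : ∀ t, 0 < p t
  integrable : Integrable p

/-- The normalised cumulative distribution function of `p`. -/
noncomputable def normCdf (p : ℝ → ℝ) (t : ℝ) : ℝ := (∫ s in Set.Iic t, p s) / ∫ s, p s

/-- The monotone map carrying the normalisation of `p` to the normalisation of `q`. -/
noncomputable def monoTransport (p q : ℝ → ℝ) (t : ℝ) : ℝ :=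
  Function.invFun (normCdf q) (normCdf p t)

namespace PosDensity

variable {p q : ℝ → ℝ}

lemma integral_pos (hp : PosDensity p) : 0 < ∫ s, p s := by
  rw [integral_pos_iff_support_of_nonneg (fun t => (hp.pos t).le) hp.integrable]
  have : Function.support p = Set.univ := by
    ext t; simpa using (hp.pos t).ne'
  simp [this]

lemma hasStrictDerivAt_normCdf (hp : PosDensity p) (t : ℝ) :
    HasStrictDerivAt (normCdf p) (p t / ∫ s, p s) t := by
  have h1 : HasStrictDerivAt (fun u => ∫ x in (0 : ℝ)..u, p x) (p t) t :=
    hp.continuous.integral_hasStrictDerivAt 0 t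
  have h2 : ∀ u, (∫ s in Set.Iic u, p s) = (∫ s in Set.Iic (0 : ℝ), p s) + ∫ x in (0 : ℝ)..u, p x := by
    intro u
    rw [← intervalIntegral.integral_Iic_sub_Iic hp.integrable.integrableOn
      hp.integrable.integrableOn]
    ring
  have h3 : normCdf p = fun u =>
      ((∫ s in Set.Iic (0 : ℝ), p s) + ∫ x in (0 : ℝ)..u, p x) / ∫ s, p s := by
    ext u; rw [normCdf, h2]
  rw [h3]
  exact (h1.const_add _).div_const _

lemma strictMono_normCdf (hp : PosDensity p) : StrictMono (normCdf p) :=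
  strictMono_of_deriv_pos fun t => by
    rw [(hp.hasStrictDerivAt_normCdf t).hasDerivAt.deriv]
    exact div_pos (hp.pos t) hp.integral_pos

lemma continuous_normCdf (hp : PosDensity p) : Continuous (normCdf p) :=
  continuous_iff_continuousAt.2 fun t => (hp.hasStrictDerivAt_normCdf t).hasDerivAt.continuousAt

lemma tendsto_normCdf_atTop (hp : PosDensity p) :
    Filter.Tendsto (normCdf p) Filter.atTop (nhds 1) := by
  have := (aecover_Iic (μ := (volume : Measure ℝ)) Filter.tendsto_id).integral_tendsto_of_countably_generated
    hp.integrable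
  have h2 := this.div_const (∫ s, p s)
  rw [div_self hp.integral_pos.ne'] at h2
  exact h2

lemma tendsto_normCdf_atBot (hp : PosDensity p) :
    Filter.Tendsto (normCdf p) Filter.atBot (nhds 0) := by
  have h := (aecover_Ioi (μ := (volume : Measure ℝ)) Filter.tendsto_id).integral_tendsto_of_countably_generated
    hp.integrable
  have h2 : ∀ t, (∫ s in Set.Iic t, p s) = (∫ s, p s) - ∫ s in Set.Ioi t, p s := fun t => by
    rw [← integral_add_compl (measurableSet_Iic (a := t)) hp.integrable, Set.compl_Iic]; ring
  have h3 := (h.const_sub (∫ s, p s)).div_const (∫ s, p s)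
  simp only [sub_self, zero_div, id] at h3
  exact h3.congr fun t => by rw [normCdf, h2]

lemma range_normCdf (hp : PosDensity p) : Set.range (normCdf p) = Set.Ioo 0 1 := by
  apply Set.Subset.antisymm
  · rintro _ ⟨t, rfl⟩
    constructor
    · refine lt_of_le_of_lt ?_ (hp.strictMono_normCdf (sub_one_lt t))
      exact hp.strictMono_normCdf.monotone.le_of_tendsto hp.tendsto_normCdf_atBot _
    · refine (hp.strictMono_normCdf (lt_add_one t)).trans_le ?_
      exact hp.strictMono_normCdf.monotone.ge_of_tendsto hp.tendsto_normCdf_atTop _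
  · intro c hc
    apply mem_range_of_exists_le_of_exists_ge hp.continuous_normCdf
    · obtain ⟨t, ht⟩ := (hp.tendsto_normCdf_atBot.eventually (gt_mem_nhds hc.1)).exists
      exact ⟨t, ht.le⟩
    · obtain ⟨t, ht⟩ := (hp.tendsto_normCdf_atTop.eventually (lt_mem_nhds hc.2)).exists
      exact ⟨t, ht.le⟩

lemma normCdf_monoTransport (hp : PosDensity p) (hq : PosDensity q) (t : ℝ) :
    normCdf q (monoTransport p q t) = normCdf p t := by
  apply Function.invFun_eq
  have : normCdf p t ∈ Set.range (normCdf q) := by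
    rw [hq.range_normCdf, ← hp.range_normCdf]; exact ⟨t, rfl⟩
  exact this

lemma monoTransport_le_iff (hp : PosDensity p) (hq : PosDensity q) (t u : ℝ) :
    monoTransport p q t ≤ u ↔ normCdf p t ≤ normCdf q u := by
  rw [← hp.normCdf_monoTransport hq, hq.strictMono_normCdf.le_iff_le]

lemma strictMono_monoTransport (hp : PosDensity p) (hq : PosDensity q) :
    StrictMono (monoTransport p q) := fun s t hst => by
  rw [← hq.strictMono_normCdf.lt_iff_lt, hp.normCdf_monoTransport hq, hp.normCdf_monoTransport hq]
  exact hp.strictMono_normCdf hst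

lemma surjective_monoTransport (hp : PosDensity p) (hq : PosDensity q) :
    Function.Surjective (monoTransport p q) := fun u => by
  refine ⟨monoTransport q p u, hq.strictMono_normCdf.injective ?_⟩
  rw [hp.normCdf_monoTransport hq, hq.normCdf_monoTransport hp]

lemma continuous_monoTransport (hp : PosDensity p) (hq : PosDensity q) :
    Continuous (monoTransport p q) :=
  (hp.strictMono_monoTransport hq).monotone.continuous_of_surjective
    (hp.surjective_monoTransport hq)

lemma hasDerivAt_monoTransport (hp : PosDensity p) (hq : PosDensity q) (t : ℝ) :
    HasDerivAt (monoTransport p q)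
      ((p t / ∫ s, p s) * ((∫ s, q s) / q (monoTransport p q t))) t := by
  have hB := hq.hasStrictDerivAt_normCdf (monoTransport p q t)
  have hne : q (monoTransport p q t) / ∫ s, q s ≠ 0 := (div_pos (hq.pos _) hq.integral_pos).ne'
  have h1 := (hB.to_localInverse hne).hasDerivAt
  rw [hp.normCdf_monoTransport hq] at h1
  have h2 := h1.comp t (hp.hasStrictDerivAt_normCdf t).hasDerivAt
  rw [inv_div, mul_comm] at h2
  refine h2.congr_of_eventuallyEq ?_
  have h3 := ((hp.continuous_monoTransport hq).tendsto t).eventually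
    (hB.eventually_left_inverse hne)
  filter_upwards [h3] with s hs
  rw [Function.comp, ← hp.normCdf_monoTransport hq s, hs]

lemma lintegral_comp_monoTransport (hp : PosDensity p) (hq : PosDensity q) (ψ : ℝ → ENNReal) :
    ∫⁻ t, ψ (monoTransport p q t) * ENNReal.ofReal (p t) =
      ENNReal.ofReal (∫ s, p s) * ∫⁻ u, ψ u * ENNReal.ofReal (q u / ∫ s, q s) := by
  have h := lintegral_image_eq_lintegral_abs_deriv_mul (s := Set.univ) MeasurableSet.univ
    (fun t _ => (hp.hasDerivAt_monoTransport hq t).hasDerivWithinAt)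
    (hp.strictMono_monoTransport hq).injective.injOn
    (fun u => ψ u * ENNReal.ofReal (q u / ∫ s, q s))
  rw [Set.image_univ, (hp.surjective_monoTransport hq).range_eq, setLIntegral_univ,
    setLIntegral_univ] at h
  rw [h, ← lintegral_const_mul' _ _ ENNReal.ofReal_ne_top]
  refine lintegral_congr fun t => ?_
  have hP := hp.integral_pos
  have hQ := hq.integral_pos
  have h1 := hp.pos t
  have h2 := hq.pos (monoTransport p q t)
  have h3 : p t = (∫ s, p s) * ((p t / ∫ s, p s) * ((∫ s, q s) / q (monoTransport p q t)) *
      (q (monoTransport p q t) / ∫ s, q s)) := by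
    field_simp
  rw [abs_of_pos (by positivity)]
  nth_rewrite 1 [h3]
  rw [ENNReal.ofReal_mul hP.le, ENNReal.ofReal_mul (by positivity)]
  ring

end PosDensity

lemma lintegral_eq_lintegral_insertNth {n : ℕ} (i : Fin (n + 1)) (f : (Fin (n + 1) → ℝ) → ENNReal)
    (hf : Measurable f) :
    ∫⁻ x, f x = ∫⁻ x' : Fin n → ℝ, ∫⁻ t : ℝ, f (i.insertNth t x') := by
  have h := (volume_preserving_piFinSuccAbove (fun _ : Fin (n + 1) => ℝ) i).symm
  rw [← h.lintegral_comp hf]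
  exact lintegral_prod_symm' _ (hf.comp h.measurable)

lemma lintegral_eq_lintegral_cons {n : ℕ} (f : (Fin (n + 1) → ℝ) → ENNReal)
    (hf : Measurable f) :
    ∫⁻ x, f x = ∫⁻ x' : Fin n → ℝ, ∫⁻ t : ℝ, f (Fin.cons t x') := by
  simpa only [Fin.insertNth_zero'] using lintegral_eq_lintegral_insertNth 0 f hf

lemma integral_eq_integral_insertNth {n : ℕ} (i : Fin (n + 1)) {f : (Fin (n + 1) → ℝ) → ℝ}
    (hf : Integrable f) :
    ∫ x, f x = ∫ x' : Fin n → ℝ, ∫ t : ℝ, f (i.insertNth t x') := by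
  have h := (volume_preserving_piFinSuccAbove (fun _ : Fin (n + 1) => ℝ) i).symm
  rw [← h.integral_comp' f]
  exact integral_prod_symm _ ((h.integrable_comp_emb
    (MeasurableEquiv.measurableEmbedding _)).2 hf)

lemma ae_integrable_insertNth {n : ℕ} (i : Fin (n + 1)) {f : (Fin (n + 1) → ℝ) → ℝ}
    (hf : Integrable f) :
    ∀ᵐ x' : Fin n → ℝ, Integrable fun t : ℝ => f (i.insertNth t x') := by
  have h := (volume_preserving_piFinSuccAbove (fun _ : Fin (n + 1) => ℝ) i).symm
  exact ((h.integrable_comp_emb (MeasurableEquiv.measurableEmbedding _)).2 hf).prod_left_ae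

lemma integral_eq_integral_cons {n : ℕ} {f : (Fin (n + 1) → ℝ) → ℝ} (hf : Integrable f) :
    ∫ x, f x = ∫ x' : Fin n → ℝ, ∫ t : ℝ, f (Fin.cons t x') := by
  simpa only [Fin.insertNth_zero'] using integral_eq_integral_insertNth 0 hf

lemma continuous_fin_cons {n : ℕ} :
    Continuous fun z : (Fin n → ℝ) × ℝ => (Fin.cons z.2 z.1 : Fin (n + 1) → ℝ) :=
  Continuous.finCons (A := fun _ => ℝ) continuous_snd continuous_fst

/-- A continuous positive function dominated by a multiple of a product of Cauchy densities. -/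
structure TameDensity {n : ℕ} (F : (Fin n → ℝ) → ℝ) : Prop where
  continuous : Continuous F
  pos : ∀ x, 0 < F x
  bound : ∃ C, ∀ x, F x ≤ C * ∏ i, (1 + x i ^ 2)⁻¹

/-- Integrate out the first variable. -/
noncomputable def marginal {n : ℕ} (F : (Fin (n + 1) → ℝ) → ℝ) (x : Fin n → ℝ) : ℝ :=
  ∫ t : ℝ, F (Fin.cons t x)

lemma prod_inv_one_add_sq_le_one {n : ℕ} (x : Fin n → ℝ) : ∏ i, (1 + x i ^ 2)⁻¹ ≤ 1 :=
  Finset.prod_le_one (fun i _ => by positivity) fun i _ =>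
    inv_le_one_of_one_le₀ (by nlinarith [sq_nonneg (x i)])

namespace TameDensity

variable {n : ℕ}

lemma exists_bound {F : (Fin n → ℝ) → ℝ} (hF : TameDensity F) :
    ∃ C, 0 < C ∧ ∀ x, F x ≤ C * ∏ i, (1 + x i ^ 2)⁻¹ := by
  obtain ⟨C, hC⟩ := hF.bound
  refine ⟨C, ?_, hC⟩
  have h0 := (hF.pos 0).trans_le (hC 0)
  exact pos_of_mul_pos_left h0 (Finset.prod_nonneg fun i _ => by positivity)

lemma integrable {F : (Fin n → ℝ) → ℝ} (hF : TameDensity F) : Integrable F := by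
  obtain ⟨C, hC0, hC⟩ := hF.exists_bound
  have h : Integrable (fun x : Fin n → ℝ => C * ∏ i, (1 + x i ^ 2)⁻¹) :=
    (Integrable.fintype_prod (f := fun (_ : Fin n) (t : ℝ) => (1 + t ^ 2)⁻¹)
      fun _ => integrable_inv_one_add_sq).const_mul C
  exact h.mono' hF.continuous.aestronglyMeasurable
    (Filter.Eventually.of_forall fun x => by
      rw [norm_of_nonneg (hF.pos x).le]; exact hC x)

variable {F : (Fin (n + 1) → ℝ) → ℝ}

lemma slice (hF : TameDensity F) (x : Fin n → ℝ) : PosDensity fun t => F (Fin.cons t x) where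
  continuous := hF.continuous.comp (continuous_fin_cons.comp (Continuous.prodMk_right x))
  pos t := hF.pos _
  integrable := by
    obtain ⟨C, hC0, hC⟩ := hF.exists_bound
    refine (integrable_inv_one_add_sq.const_mul (C * ∏ i, (1 + x i ^ 2)⁻¹)).mono'
      (hF.continuous.comp (continuous_fin_cons.comp (Continuous.prodMk_right x))).aestronglyMeasurable
      (Filter.Eventually.of_forall fun t => ?_)
    rw [norm_of_nonneg (hF.pos _).le]
    refine (hC _).trans_eq ?_
    simp only [Fin.prod_univ_succ, Fin.cons_zero, Fin.cons_succ]
    ring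

lemma marginal (hF : TameDensity F) : TameDensity (marginal F) where
  continuous := by
    obtain ⟨C, hC0, hC⟩ := hF.exists_bound
    refine continuous_of_dominated (bound := fun t => C * (1 + t ^ 2)⁻¹)
      (fun x => (hF.slice x).continuous.aestronglyMeasurable)
      (fun x => Filter.Eventually.of_forall fun t => ?_) (integrable_inv_one_add_sq.const_mul C)
      (Filter.Eventually.of_forall fun t =>
        hF.continuous.comp (continuous_fin_cons.comp (Continuous.prodMk_left t)))
    rw [norm_of_nonneg (hF.pos _).le]
    refine (hC _).trans ?_
    simp only [Fin.prod_univ_succ, Fin.cons_zero, Fin.cons_succ]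
    have h1 := prod_inv_one_add_sq_le_one x
    gcongr
    exact mul_le_of_le_one_right (by positivity) h1
  pos x := (hF.slice x).integral_pos
  bound := by
    obtain ⟨C, hC0, hC⟩ := hF.exists_bound
    refine ⟨C * ∫ t : ℝ, (1 + t ^ 2)⁻¹, fun x => ?_⟩
    have h : C * (∫ t : ℝ, (1 + t ^ 2)⁻¹) * ∏ i, (1 + x i ^ 2)⁻¹ =
        ∫ t : ℝ, (C * ∏ i, (1 + x i ^ 2)⁻¹) * (1 + t ^ 2)⁻¹ := by
      rw [integral_const_mul]; ring
    rw [h]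
    refine integral_mono (hF.slice x).integrable (integrable_inv_one_add_sq.const_mul _) fun t => ?_
    refine (hC _).trans_eq ?_
    simp only [Fin.prod_univ_succ, Fin.cons_zero, Fin.cons_succ]
    ring

lemma integral_marginal (hF : TameDensity F) : ∫ x, _root_.marginal F x = ∫ x, F x :=
  (integral_eq_integral_cons hF.integrable).symm

lemma measurable_normCdf_slice (hF : TameDensity F) :
    Measurable fun z : (Fin n → ℝ) × ℝ => normCdf (fun t => F (Fin.cons t z.1)) z.2 := by
  unfold normCdf
  refine Measurable.div ?_ (hF.marginal.continuous.measurable.comp measurable_fst)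
  have h : (fun z : (Fin n → ℝ) × ℝ => ∫ s in Set.Iic z.2, F (Fin.cons s z.1)) =
      fun z => ∫ s, ({w : ((Fin n → ℝ) × ℝ) × ℝ | w.2 ≤ w.1.2}.indicator
        (fun w => F (Fin.cons w.2 w.1.1))) (z, s) := by
    ext z
    rw [← integral_indicator measurableSet_Iic]
    rfl
  rw [h]
  refine StronglyMeasurable.measurable (StronglyMeasurable.integral_prod_right
    (f := fun z s => ({w : ((Fin n → ℝ) × ℝ) × ℝ | w.2 ≤ w.1.2}.indicator
        (fun w => F (Fin.cons w.2 w.1.1))) (z, s)) ?_)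
  refine StronglyMeasurable.indicator ?_ (measurableSet_le measurable_snd measurable_fst.snd)
  exact (hF.continuous.comp (continuous_fin_cons.comp
    (continuous_fst.fst.prodMk continuous_snd))).stronglyMeasurable

end TameDensity

/-- A triangular increasing map `T`, with diagonal partial derivatives `D`, which transports the
density `F` to the density `G`. -/
structure IsTriangularTransport {n : ℕ} (F G : (Fin n → ℝ) → ℝ)
    (T D : (Fin n → ℝ) → Fin n → ℝ) : Prop where
  measurable : Measurable T
  measurable_diag : ∀ i, Measurable fun x => D x i
  diag_pos : ∀ x i, 0 < D x i
  hasDerivAt : ∀ x i, HasDerivAt (fun t => T (Function.update x i t) i) (D x i) (x i)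
  continuous_diag : ∀ x i, Continuous fun t => D (Function.update x i t) i
  eq_mul_prod : ∀ x, F x = G (T x) * ∏ i, D x i
  lintegral_comp : ∀ φ : (Fin n → ℝ) → ENNReal, Measurable φ →
    ∫⁻ x, φ (T x) * ENNReal.ofReal (F x) = ∫⁻ y, φ y * ENNReal.ofReal (G y)

lemma isTriangularTransport_zero {F G : (Fin 0 → ℝ) → ℝ} (h : ∫ x, F x = ∫ y, G y) :
    IsTriangularTransport F G id (fun _ _ => 1) := by
  have h0 : F = G := by
    ext x
    rw [integral_unique, integral_unique] at h
    have hv : (volume : Measure (Fin 0 → ℝ)).real Set.univ = 1 := by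
      simp [Measure.real, volume_pi]
    rw [hv, one_smul, one_smul] at h
    convert h
  subst h0
  exact ⟨measurable_id, fun i => i.elim0, fun _ i => i.elim0, fun _ i => i.elim0,
    fun _ i => i.elim0, fun x => by simp, fun φ _ => rfl⟩

/-- The map extending `T'` to one more variable by the monotone transport of the slices. -/
noncomputable def extendTransport {n : ℕ} (F G : (Fin (n + 1) → ℝ) → ℝ)
    (T' : (Fin n → ℝ) → Fin n → ℝ) (x : Fin (n + 1) → ℝ) : Fin (n + 1) → ℝ :=
  Fin.cons (monoTransport (fun t => F (Fin.cons t (Fin.tail x)))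
    (fun t => G (Fin.cons t (T' (Fin.tail x)))) (x 0)) (T' (Fin.tail x))

/-- The diagonal partial derivatives of `extendTransport`. -/
noncomputable def extendDiag {n : ℕ} (F G : (Fin (n + 1) → ℝ) → ℝ)
    (T' D' : (Fin n → ℝ) → Fin n → ℝ) (x : Fin (n + 1) → ℝ) : Fin (n + 1) → ℝ :=
  Fin.cons ((F x / marginal F (Fin.tail x)) *
    (marginal G (T' (Fin.tail x)) / G (extendTransport F G T' x))) (D' (Fin.tail x))

lemma measurable_fin_tail {n : ℕ} :
    Measurable (Fin.tail : (Fin (n + 1) → ℝ) → Fin n → ℝ) :=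
  measurable_pi_lambda _ fun _ => measurable_pi_apply _

lemma measurable_fin_cons {n : ℕ} {f : (Fin (n + 1) → ℝ) → ℝ}
    {g : (Fin (n + 1) → ℝ) → Fin n → ℝ} (hf : Measurable f) (hg : Measurable g) :
    Measurable fun x => (Fin.cons (f x) (g x) : Fin (n + 1) → ℝ) :=
  (continuous_fin_cons (n := n)).measurable.comp (hg.prodMk hf)

lemma measurable_extendTransport {n : ℕ} {F G : (Fin (n + 1) → ℝ) → ℝ} (hF : TameDensity F)
    (hG : TameDensity G) {T' : (Fin n → ℝ) → Fin n → ℝ} (hT : Measurable T') :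
    Measurable (extendTransport F G T') := by
  refine measurable_fin_cons (measurable_of_Iic fun u => ?_) (hT.comp measurable_fin_tail)
  have h : (fun x : Fin (n + 1) → ℝ => monoTransport (fun t => F (Fin.cons t (Fin.tail x)))
      (fun t => G (Fin.cons t (T' (Fin.tail x)))) (x 0)) ⁻¹' Set.Iic u =
      {x | normCdf (fun t => F (Fin.cons t (Fin.tail x))) (x 0) ≤
        normCdf (fun t => G (Fin.cons t (T' (Fin.tail x)))) u} := by
    ext x
    exact (hF.slice _).monoTransport_le_iff (hG.slice _) _ _
  rw [h]
  exact measurableSet_le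
    (hF.measurable_normCdf_slice.comp (measurable_fin_tail.prodMk (measurable_pi_apply 0)))
    (hG.measurable_normCdf_slice.comp
      ((hT.comp measurable_fin_tail).prodMk measurable_const))

lemma IsTriangularTransport.extend {n : ℕ} {F G : (Fin (n + 1) → ℝ) → ℝ} (hF : TameDensity F)
    (hG : TameDensity G) {T' D' : (Fin n → ℝ) → Fin n → ℝ}
    (h : IsTriangularTransport (marginal F) (marginal G) T' D') :
    IsTriangularTransport F G (extendTransport F G T') (extendDiag F G T' D') where
  measurable := measurable_extendTransport hF hG h.measurable
  measurable_diag i := by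
    refine (measurable_pi_apply i).comp (measurable_fin_cons ?_ ?_)
    · refine Measurable.mul (Measurable.div hF.continuous.measurable
        (hF.marginal.continuous.measurable.comp measurable_fin_tail)) (Measurable.div
        (hG.marginal.continuous.measurable.comp (h.measurable.comp measurable_fin_tail))
        (hG.continuous.measurable.comp (measurable_extendTransport hF hG h.measurable)))
    · exact (measurable_pi_lambda _ fun i => h.measurable_diag i).comp measurable_fin_tail
  diag_pos x i := by
    refine Fin.cases ?_ (fun j => ?_) i
    · exact mul_pos (div_pos (hF.pos _) (hF.marginal.pos _))
        (div_pos (hG.marginal.pos _) (hG.pos _))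
    · exact h.diag_pos _ j
  hasDerivAt x i := by
    refine Fin.cases ?_ (fun j => ?_) i
    · have := (hF.slice (Fin.tail x)).hasDerivAt_monoTransport (hG.slice (T' (Fin.tail x))) (x 0)
      simpa only [extendTransport, extendDiag, Fin.cons_zero, Fin.tail_update_zero,
        Function.update_self, Fin.cons_self_tail, marginal] using this
    · simpa only [extendTransport, extendDiag, Fin.cons_succ, Fin.tail_update_succ, Fin.tail]
        using h.hasDerivAt (Fin.tail x) j
  continuous_diag x i := by
    refine Fin.cases ?_ (fun j => ?_) i
    · have h1 : ∀ t, Function.update x 0 t = Fin.cons t (Fin.tail x) := fun t => by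
        conv_lhs => rw [← Fin.cons_self_tail x, Fin.update_cons_zero]
      simp only [extendTransport, extendDiag, Fin.cons_zero, h1, Fin.tail_cons]
      have hc := (hF.slice (Fin.tail x)).continuous_monoTransport (hG.slice (T' (Fin.tail x)))
      refine ((hF.slice (Fin.tail x)).continuous.div_const _).mul (continuous_const.div
        ((hG.slice (T' (Fin.tail x))).continuous.comp hc) fun t => (hG.pos _).ne')
    · simpa only [extendDiag, Fin.cons_succ, Fin.tail_update_succ]
        using h.continuous_diag (Fin.tail x) j
  eq_mul_prod x := by
    have h1 := h.eq_mul_prod (Fin.tail x)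
    have h2 := hF.marginal.pos (Fin.tail x)
    have h3 := hG.marginal.pos (T' (Fin.tail x))
    have h4 := hG.pos (extendTransport F G T' x)
    rw [Fin.prod_univ_succ]
    simp only [extendDiag, Fin.cons_zero, Fin.cons_succ]
    have h5 : ∏ i, D' (Fin.tail x) i = marginal F (Fin.tail x) / marginal G (T' (Fin.tail x)) := by
      rw [h1]; field_simp
    rw [h5]; field_simp
  lintegral_comp φ hφ := by
    have hm : Measurable fun z : (Fin n → ℝ) × ℝ =>
        φ (Fin.cons z.2 z.1) * ENNReal.ofReal (G (Fin.cons z.2 z.1) / marginal G z.1) :=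
      (hφ.comp continuous_fin_cons.measurable).mul
        ((hG.continuous.measurable.comp continuous_fin_cons.measurable).div
          (hG.marginal.continuous.measurable.comp measurable_fst)).ennreal_ofReal
    have hm1 : Measurable fun x => φ (extendTransport F G T' x) * ENNReal.ofReal (F x) :=
      (hφ.comp (measurable_extendTransport hF hG h.measurable)).mul
        hF.continuous.measurable.ennreal_ofReal
    have hm2 : Measurable fun y => φ y * ENNReal.ofReal (G y) :=
      hφ.mul hG.continuous.measurable.ennreal_ofReal
    rw [lintegral_eq_lintegral_cons _ hm1, lintegral_eq_lintegral_cons _ hm2]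
    have h1 : ∀ x' : Fin n → ℝ,
        ∫⁻ t, φ (extendTransport F G T' (Fin.cons t x')) * ENNReal.ofReal (F (Fin.cons t x')) =
        (∫⁻ u, φ (Fin.cons u (T' x')) *
          ENNReal.ofReal (G (Fin.cons u (T' x')) / marginal G (T' x'))) *
          ENNReal.ofReal (marginal F x') := fun x' => by
      have := (hF.slice x').lintegral_comp_monoTransport (hG.slice (T' x'))
        (fun u => φ (Fin.cons u (T' x')))
      rw [mul_comm (∫⁻ u, _)]
      simpa only [extendTransport, Fin.cons_zero, Fin.tail_cons, marginal] using this
    simp_rw [h1]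
    rw [h.lintegral_comp (fun y => ∫⁻ u, φ (Fin.cons u y) *
      ENNReal.ofReal (G (Fin.cons u y) / marginal G y)) hm.lintegral_prod_right']
    refine lintegral_congr fun y => ?_
    rw [← lintegral_mul_const' _ _ ENNReal.ofReal_ne_top]
    refine lintegral_congr fun u => ?_
    have h2 := hG.marginal.pos y
    rw [mul_assoc, ← ENNReal.ofReal_mul (div_nonneg (hG.pos _).le h2.le), div_mul_cancel₀ _ h2.ne']

/-- The Knothe–Rosenblatt rearrangement. -/
theorem exists_isTriangularTransport {n : ℕ} {F G : (Fin n → ℝ) → ℝ} (hF : TameDensity F)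
    (hG : TameDensity G) (h : ∫ x, F x = ∫ y, G y) : ∃ T D, IsTriangularTransport F G T D := by
  induction n with
  | zero => exact ⟨_, _, isTriangularTransport_zero h⟩
  | succ n ih =>
    obtain ⟨T', D', hT⟩ := ih hF.marginal hG.marginal
      (by rw [hF.integral_marginal, hG.integral_marginal, h])
    exact ⟨_, _, hT.extend hF hG⟩

end

section

open Filter Topology

lemma exists_ge_abs_lt_of_integrable_sq {φ : ℝ → ℝ} (h : Integrable fun t => φ t ^ 2)
    {δ : ℝ} (hδ : 0 < δ) (R : ℝ) : ∃ x ≥ R, |φ x| < δ := by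
  by_contra! hc
  have h1 : Integrable (fun _ : ℝ => δ ^ 2) (volume.restrict (Set.Ici R)) := by
    refine (h.integrableOn (s := Set.Ici R)).mono' aestronglyMeasurable_const ?_
    filter_upwards [ae_restrict_mem measurableSet_Ici] with t ht
    rw [norm_of_nonneg (by positivity), ← sq_abs (φ t)]
    exact pow_le_pow_left₀ hδ.le (hc t ht) 2
  rw [integrable_const_iff] at h1
  rcases h1 with h1 | h1
  · exact hδ.ne' (by simpa using h1)
  · exact absurd h1.measure_univ_lt_top (by simp)

lemma exists_le_abs_lt_of_integrable_sq {φ : ℝ → ℝ} (h : Integrable fun t => φ t ^ 2)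
    {δ : ℝ} (hδ : 0 < δ) (R : ℝ) : ∃ x ≤ R, |φ x| < δ := by
  obtain ⟨x, hx, h1⟩ := exists_ge_abs_lt_of_integrable_sq (φ := fun t => φ (-t)) h.comp_neg hδ (-R)
  exact ⟨-x, by linarith, h1⟩

lemma exists_seq_tendsto_of_integrable_sq {φ : ℝ → ℝ} (h : Integrable fun t => φ t ^ 2) :
    ∃ a b : ℕ → ℝ, Tendsto a atTop atBot ∧ Tendsto b atTop atTop ∧
      Tendsto (fun k => φ (a k)) atTop (𝓝 0) ∧ Tendsto (fun k => φ (b k)) atTop (𝓝 0) := by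
  have hk : ∀ k : ℕ, (0 : ℝ) < 1 / ((k : ℝ) + 1) := fun k => Nat.one_div_pos_of_nat
  choose a ha1 ha2 using fun k : ℕ => exists_le_abs_lt_of_integrable_sq h (hk k) (-(k : ℝ))
  choose b hb1 hb2 using fun k : ℕ => exists_ge_abs_lt_of_integrable_sq h (hk k) (k : ℝ)
  refine ⟨a, b, tendsto_atBot_mono ha1 (tendsto_neg_atTop_atBot.comp tendsto_natCast_atTop_atTop),
    tendsto_atTop_mono hb1 tendsto_natCast_atTop_atTop, ?_, ?_⟩
  · exact squeeze_zero_norm (fun k => (ha2 k).le) tendsto_one_div_add_atTop_nhds_zero_nat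
  · exact squeeze_zero_norm (fun k => (hb2 k).le) tendsto_one_div_add_atTop_nhds_zero_nat

lemma integral_mul_deriv_eq_of_nonneg {q q' T D : ℝ → ℝ} (hq : ∀ t, HasDerivAt q (q' t) t)
    (hT : ∀ t, HasDerivAt T (D t) t) (hDc : Continuous D) (hq0 : ∀ t, 0 ≤ q t) (hD0 : ∀ t, 0 ≤ D t)
    (hint : Integrable fun t => q' t * T t) (hsq : Integrable fun t => (q t * T t) ^ 2) :
    Integrable (fun t => q t * D t) ∧ ∫ t, q t * D t = -∫ t, q' t * T t := by
  obtain ⟨a, b, ha, hb, hqa, hqb⟩ := exists_seq_tendsto_of_integrable_sq hsq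
  have hqc : Continuous q := continuous_iff_continuousAt.2 fun t => (hq t).continuousAt
  have hc : Continuous fun t => q t * D t := hqc.mul hDc
  have h1 : ∀ k, ∫ t in a k..b k, q t * D t =
      q (b k) * T (b k) - q (a k) * T (a k) - ∫ t in a k..b k, q' t * T t := fun k => by
    have := intervalIntegral.integral_eq_sub_of_hasDerivAt (a := a k) (b := b k)
      (fun t _ => (hq t).mul (hT t)) (hint.intervalIntegrable.add (hc.intervalIntegrable _ _))
    rw [intervalIntegral.integral_add hint.intervalIntegrable (hc.intervalIntegrable _ _)] at this
    simp only [Pi.mul_apply] at this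
    linarith
  have h2 : Tendsto (fun k => ∫ t in a k..b k, q t * D t) atTop (𝓝 (-∫ t, q' t * T t)) := by
    simp_rw [h1]
    simpa using (hqb.sub hqa).sub (intervalIntegral_tendsto_integral hint ha hb)
  have h3 : Integrable fun t => q t * D t := by
    refine integrable_of_intervalIntegral_norm_tendsto _
      (fun k => (hc.integrableOn_Icc).mono_set Set.Ioc_subset_Icc_self) ha hb (h2.congr fun k => ?_)
    exact intervalIntegral.integral_congr fun t _ =>
      (norm_of_nonneg (mul_nonneg (hq0 t) (hD0 t))).symm
  exact ⟨h3, tendsto_nhds_unique (intervalIntegral_tendsto_integral h3 ha hb) h2⟩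

lemma integrable_and_integral_eq_of_lintegral_eq {α : Type*} [MeasurableSpace α] {μ : Measure α}
    {f : α → ℝ} {c : ℝ} (hf : Measurable f) (hf0 : ∀ x, 0 ≤ f x) (hc : 0 ≤ c)
    (h : ∫⁻ x, ENNReal.ofReal (f x) ∂μ = ENNReal.ofReal c) :
    Integrable f μ ∧ ∫ x, f x ∂μ = c := by
  constructor
  · refine ⟨hf.aestronglyMeasurable, ?_⟩
    rw [hasFiniteIntegral_iff_ofReal (Eventually.of_forall hf0), h]
    exact ENNReal.ofReal_lt_top
  · rw [integral_eq_lintegral_of_nonneg_ae (Eventually.of_forall hf0) hf.aestronglyMeasurable, h,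
      ENNReal.toReal_ofReal hc]

lemma lintegral_ofReal_exp_neg_mul_sq_norm {n : ℕ} {t : ℝ} (ht : 0 < t) :
    ∫⁻ x : EuclideanSpace ℝ (Fin n), ENNReal.ofReal (exp (-t * ‖x‖ ^ 2)) =
      ENNReal.ofReal ((π / t) ^ ((n : ℝ) / 2)) := by
  have h1 := GaussianFourier.integral_rexp_neg_mul_sq_norm (V := EuclideanSpace ℝ (Fin n)) ht
  rw [finrank_euclideanSpace_fin] at h1
  have h2 : Integrable fun x : EuclideanSpace ℝ (Fin n) => exp (-t * ‖x‖ ^ 2) := by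
    by_contra h
    rw [integral_undef h] at h1
    exact absurd h1 (by positivity)
  rw [← h1, ofReal_integral_eq_lintegral_ofReal h2 (Eventually.of_forall fun x => (exp_pos _).le)]

lemma lintegral_ofReal_rpow_mul_exp {k r : ℝ} (hk : 0 < k) (hr : 0 < r) :
    ∫⁻ t in Set.Ioi (0 : ℝ), ENNReal.ofReal (t ^ (k - 1) * exp (-(r * t))) =
      ENNReal.ofReal (r ^ (-k) * Gamma k) := by
  have h1 := integral_rpow_mul_exp_neg_mul_Ioi hk hr
  have h0 : 0 < (1 / r) ^ k * Gamma k := by have := Gamma_pos_of_pos hk; positivity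
  have h2 : IntegrableOn (fun t => t ^ (k - 1) * exp (-(r * t))) (Set.Ioi (0 : ℝ)) := by
    by_contra h
    rw [integral_undef h] at h1
    exact h0.ne h1
  rw [← ofReal_integral_eq_lintegral_ofReal h2, h1]
  · rw [one_div, inv_rpow hr.le, rpow_neg hr.le]
  · filter_upwards [ae_restrict_mem measurableSet_Ioi] with t ht
    have : 0 < t := ht
    positivity

/-- The integral of `(1 + |x|²)^(-k)` over Euclidean space. -/
lemma integral_one_add_sq_norm_rpow {n : ℕ} {k : ℝ} (hk : (n : ℝ) / 2 < k) :
    Integrable (fun x : EuclideanSpace ℝ (Fin n) => (1 + ‖x‖ ^ 2) ^ (-k)) ∧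
    ∫ x : EuclideanSpace ℝ (Fin n), (1 + ‖x‖ ^ 2) ^ (-k) =
      π ^ ((n : ℝ) / 2) * Gamma (k - n / 2) / Gamma k := by
  have hk0 : 0 < k := lt_of_le_of_lt (by positivity) hk
  have hG := Gamma_pos_of_pos hk0
  have hG2 := Gamma_pos_of_pos (sub_pos.2 hk)
  have hp : ∀ x : EuclideanSpace ℝ (Fin n), 0 < 1 + ‖x‖ ^ 2 := fun x => by positivity
  refine integrable_and_integral_eq_of_lintegral_eq (by fun_prop)
    (fun x => (rpow_pos_of_pos (hp x) _).le) (by positivity) ?_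
  have h1 : (∫⁻ x : EuclideanSpace ℝ (Fin n), ENNReal.ofReal ((1 + ‖x‖ ^ 2) ^ (-k))) *
      ENNReal.ofReal (Gamma k) = ENNReal.ofReal (π ^ ((n : ℝ) / 2) * Gamma (k - n / 2)) := by
    rw [← lintegral_mul_const' _ _ ENNReal.ofReal_ne_top]
    calc ∫⁻ x : EuclideanSpace ℝ (Fin n),
          ENNReal.ofReal ((1 + ‖x‖ ^ 2) ^ (-k)) * ENNReal.ofReal (Gamma k)
        = ∫⁻ x : EuclideanSpace ℝ (Fin n), ∫⁻ t in Set.Ioi (0 : ℝ),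
            ENNReal.ofReal (t ^ (k - 1) * exp (-((1 + ‖x‖ ^ 2) * t))) :=
          lintegral_congr fun x => by
            rw [lintegral_ofReal_rpow_mul_exp hk0 (hp x),
              ENNReal.ofReal_mul (rpow_pos_of_pos (hp x) _).le]
      _ = ∫⁻ t in Set.Ioi (0 : ℝ), ∫⁻ x : EuclideanSpace ℝ (Fin n),
            ENNReal.ofReal (t ^ (k - 1) * exp (-((1 + ‖x‖ ^ 2) * t))) := by
          refine lintegral_lintegral_swap (Measurable.aemeasurable ?_)
          refine Measurable.ennreal_ofReal (Measurable.mul ?_ ?_) <;> fun_prop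
      _ = ∫⁻ t in Set.Ioi (0 : ℝ), ENNReal.ofReal (π ^ ((n : ℝ) / 2)) *
            ENNReal.ofReal (t ^ (k - n / 2 - 1) * exp (-(1 * t))) := by
          refine setLIntegral_congr_fun measurableSet_Ioi fun t ht => ?_
          have ht : 0 < t := ht
          have h2 : ∀ x : EuclideanSpace ℝ (Fin n),
              ENNReal.ofReal (t ^ (k - 1) * exp (-((1 + ‖x‖ ^ 2) * t))) =
              ENNReal.ofReal (t ^ (k - 1) * exp (-t)) * ENNReal.ofReal (exp (-t * ‖x‖ ^ 2)) :=
            fun x => by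
              rw [← ENNReal.ofReal_mul (by positivity), mul_assoc, ← exp_add]
              ring_nf
          simp_rw [h2]
          rw [lintegral_const_mul' _ _ ENNReal.ofReal_ne_top,
            lintegral_ofReal_exp_neg_mul_sq_norm ht, ← ENNReal.ofReal_mul (by positivity),
            ← ENNReal.ofReal_mul (by positivity), div_rpow pi_pos.le ht.le,
            show k - n / 2 - 1 = (k - 1) - n / 2 by ring, rpow_sub ht (k - 1), one_mul]
          congr 1
          ring
      _ = ENNReal.ofReal (π ^ ((n : ℝ) / 2) * Gamma (k - n / 2)) := by
          rw [lintegral_const_mul' _ _ ENNReal.ofReal_ne_top,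
            lintegral_ofReal_rpow_mul_exp (sub_pos.2 hk) one_pos, one_rpow, one_mul,
            ← ENNReal.ofReal_mul (by positivity)]
  rw [ENNReal.ofReal_div_of_pos hG, ← h1, ENNReal.mul_div_cancel_right
    (ENNReal.ofReal_pos.2 hG).ne' ENNReal.ofReal_ne_top]

lemma IsTriangularTransport.integral_mul_diag {m : ℕ} (hm : 1 ≤ m)
    {F G : (Fin (m + 1) → ℝ) → ℝ} {T D : (Fin (m + 1) → ℝ) → Fin (m + 1) → ℝ}
    (h : IsTriangularTransport F G T D) (i : Fin (m + 1)) {q q' : (Fin (m + 1) → ℝ) → ℝ}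
    (hq : Measurable q) (hq0 : ∀ x, 0 ≤ q x)
    (hd : ∀ x, x ≠ 0 → HasDerivAt (fun t => q (Function.update x i t)) (q' x) (x i))
    (hint : Integrable fun x => q' x * T x i) (hsq : Integrable fun x => (q x * T x i) ^ 2) :
    Integrable (fun x => q x * D x i) ∧ ∫ x, q x * D x i = -∫ x, q' x * T x i := by
  have : Nonempty (Fin m) := ⟨⟨0, hm⟩⟩
  have hne : ∀ᵐ x' : Fin m → ℝ, x' ≠ 0 := by
    rw [ae_iff]; simp
  have hline : ∀ᵐ x' : Fin m → ℝ,
      Integrable (fun t => q (i.insertNth t x') * D (i.insertNth t x') i) ∧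
      ∫ t, q (i.insertNth t x') * D (i.insertNth t x') i =
        -∫ t, q' (i.insertNth t x') * T (i.insertNth t x') i := by
    filter_upwards [hne, ae_integrable_insertNth i hint, ae_integrable_insertNth i hsq]
      with x' hx' h1 h2
    refine integral_mul_deriv_eq_of_nonneg (fun t => ?_) (fun t => ?_) ?_ (fun t => hq0 _)
      (fun t => (h.diag_pos _ i).le) h1 h2
    · have := hd (i.insertNth t x') fun h0 => hx' (by
        ext j
        have := congrFun h0 (i.succAbove j)
        simpa using this)
      simpa [Fin.update_insertNth] using this
    · simpa [Fin.update_insertNth] using h.hasDerivAt (i.insertNth t x') i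
    · simpa [Fin.update_insertNth] using h.continuous_diag (i.insertNth 0 x') i
  have hnn : ∀ x, 0 ≤ q x * D x i := fun x => mul_nonneg (hq0 x) (h.diag_pos x i).le
  have hmeas : Measurable fun x => q x * D x i := hq.mul (h.measurable_diag i)
  have hfin : Integrable fun x => q x * D x i := by
    refine ⟨hmeas.aestronglyMeasurable, ?_⟩
    rw [hasFiniteIntegral_iff_ofReal (Eventually.of_forall hnn),
      lintegral_eq_lintegral_insertNth i _ hmeas.ennreal_ofReal]
    have hle : ∫⁻ x' : Fin m → ℝ, ∫⁻ t, ENNReal.ofReal (q (i.insertNth t x') *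
        D (i.insertNth t x') i) ≤ ∫⁻ x' : Fin m → ℝ,
        ‖∫ t, q' (i.insertNth t x') * T (i.insertNth t x') i‖ₑ := by
      refine lintegral_mono_ae ?_
      filter_upwards [hline] with x' hx'
      rw [← ofReal_integral_eq_lintegral_ofReal hx'.1 (Eventually.of_forall fun t => hnn _), hx'.2,
        ← enorm_neg]
      exact Real.ofReal_le_enorm _
    refine hle.trans_lt ?_
    have hp := (volume_preserving_piFinSuccAbove (fun _ : Fin (m + 1) => ℝ) i).symm
    exact ((hp.integrable_comp_emb (MeasurableEquiv.measurableEmbedding _)).2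
      hint).integral_prod_right.hasFiniteIntegral
  refine ⟨hfin, ?_⟩
  rw [integral_eq_integral_insertNth i hfin, integral_eq_integral_insertNth i hint, ← integral_neg]
  exact integral_congr_ae (hline.mono fun x' hx' => hx'.2)

/-- The integral of `(1 + |x|²)^(-n)` over `n`-dimensional space. -/
noncomputable def bubbleMass (n : ℕ) : ℝ := π ^ ((n : ℝ) / 2) * Gamma ((n : ℝ) / 2) / Gamma n

lemma bubbleMass_pos {n : ℕ} (hn : 3 ≤ n) : 0 < bubbleMass n := by
  have hN : (3 : ℝ) ≤ n := by exact_mod_cast hn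
  have h1 := Gamma_pos_of_pos (show (0 : ℝ) < n / 2 by linarith)
  have h2 := Gamma_pos_of_pos (show (0 : ℝ) < n by linarith)
  unfold bubbleMass
  positivity

lemma integral_one_add_sum_sq_rpow {n : ℕ} {k : ℝ} (hk : (n : ℝ) / 2 < k) :
    Integrable (fun x : Fin n → ℝ => (1 + ∑ i, x i ^ 2) ^ (-k)) ∧
    ∫ x : Fin n → ℝ, (1 + ∑ i, x i ^ 2) ^ (-k) =
      π ^ ((n : ℝ) / 2) * Gamma (k - n / 2) / Gamma k := by
  obtain ⟨h1, h2⟩ := integral_one_add_sq_norm_rpow hk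
  have hp := PiLp.volume_preserving_ofLp (Fin n)
  have he : MeasurableEmbedding (WithLp.ofLp : EuclideanSpace ℝ (Fin n) → Fin n → ℝ) :=
    (MeasurableEquiv.toLp 2 (Fin n → ℝ)).symm.measurableEmbedding
  simp only [EuclideanSpace.real_norm_sq_eq] at h1 h2
  refine ⟨(hp.integrable_comp_emb he).1 h1, ?_⟩
  rw [← h2]
  exact (hp.integral_comp he _).symm

lemma integral_bubble {n : ℕ} (hn : 3 ≤ n) :
    Integrable (fun x : Fin n → ℝ => (1 + ∑ i, x i ^ 2) ^ (-(n : ℝ))) ∧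
    ∫ x : Fin n → ℝ, (1 + ∑ i, x i ^ 2) ^ (-(n : ℝ)) = bubbleMass n := by
  have hN : (3 : ℝ) ≤ n := by exact_mod_cast hn
  have := integral_one_add_sum_sq_rpow (n := n) (k := n) (by linarith)
  rwa [sub_half] at this

lemma integral_bubble_sub_one {n : ℕ} (hn : 3 ≤ n) :
    Integrable (fun x : Fin n → ℝ => (1 + ∑ i, x i ^ 2) ^ (-((n : ℝ) - 1))) ∧
    ∫ x : Fin n → ℝ, (1 + ∑ i, x i ^ 2) ^ (-((n : ℝ) - 1)) =
      2 * ((n : ℝ) - 1) / (n - 2) * bubbleMass n := by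
  have hN : (3 : ℝ) ≤ n := by exact_mod_cast hn
  have := integral_one_add_sum_sq_rpow (n := n) (k := n - 1) (by linarith)
  refine ⟨this.1, this.2.trans ?_⟩
  have h1 := Gamma_add_one (show (n : ℝ) / 2 - 1 ≠ 0 by linarith)
  have h2 := Gamma_add_one (show (n : ℝ) - 1 ≠ 0 by linarith)
  have h3 := Gamma_pos_of_pos (show (0 : ℝ) < n - 1 by linarith)
  rw [sub_add_cancel] at h1 h2
  rw [bubbleMass, h1, h2, show (n : ℝ) - 1 - n / 2 = n / 2 - 1 by ring]
  have h4 : (n : ℝ) - 2 ≠ 0 := by linarith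
  have h5 : (n : ℝ) - 1 ≠ 0 := by linarith
  field_simp

lemma integral_sum_sq_mul_bubble {n : ℕ} (hn : 3 ≤ n) :
    Integrable (fun x : Fin n → ℝ => (∑ i, x i ^ 2) * (1 + ∑ i, x i ^ 2) ^ (-(n : ℝ))) ∧
    ∫ x : Fin n → ℝ, (∑ i, x i ^ 2) * (1 + ∑ i, x i ^ 2) ^ (-(n : ℝ)) =
      n / ((n : ℝ) - 2) * bubbleMass n := by
  have hN : (3 : ℝ) ≤ n := by exact_mod_cast hn
  obtain ⟨h1, h2⟩ := integral_bubble hn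
  obtain ⟨h3, h4⟩ := integral_bubble_sub_one hn
  have h5 : (fun x : Fin n → ℝ => (∑ i, x i ^ 2) * (1 + ∑ i, x i ^ 2) ^ (-(n : ℝ))) =
      fun x => (1 + ∑ i, x i ^ 2) ^ (-((n : ℝ) - 1)) - (1 + ∑ i, x i ^ 2) ^ (-(n : ℝ)) := by
    ext x
    have hx : 0 < 1 + ∑ i, x i ^ 2 := by positivity
    rw [show -((n : ℝ) - 1) = -n + 1 by ring, rpow_add_one hx.ne']
    ring
  rw [h5]
  refine ⟨h3.sub h1, ?_⟩
  rw [integral_sub h3 h1, h2, h4]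
  have h6 : (n : ℝ) - 2 ≠ 0 := by linarith
  field_simp
  ring

lemma tameDensity_bubble {n : ℕ} {c : ℝ} (hc : 0 < c) :
    TameDensity fun x : Fin n → ℝ => c * (1 + ∑ i, x i ^ 2) ^ (-(n : ℝ)) where
  continuous := by
    refine continuous_const.mul (Continuous.rpow_const (by fun_prop) fun x => Or.inl ?_)
    positivity
  pos x := by positivity
  bound := by
    refine ⟨c, fun x => mul_le_mul_of_nonneg_left ?_ hc.le⟩
    have hx : 0 ≤ 1 + ∑ i, x i ^ 2 := by positivity
    rw [rpow_neg hx, rpow_natCast, Finset.prod_inv_distrib]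
    refine inv_anti₀ (Finset.prod_pos fun i _ => by positivity) ?_
    calc ∏ i, (1 + x i ^ 2) ≤ ∏ _i : Fin n, (1 + ∑ i, x i ^ 2) :=
          Finset.prod_le_prod (fun i _ => by positivity) fun i hi => by
            gcongr
            exact Finset.single_le_sum (f := fun i => x i ^ 2) (fun j _ => sq_nonneg _) hi
      _ = _ := by simp

lemma IsTriangularTransport.integral_comp {n : ℕ} {F G : (Fin n → ℝ) → ℝ}
    {T D : (Fin n → ℝ) → Fin n → ℝ} (h : IsTriangularTransport F G T D) (hF : Measurable F)
    (hF0 : ∀ x, 0 ≤ F x) (hG0 : ∀ x, 0 ≤ G x) {φ : (Fin n → ℝ) → ℝ} (hφ : Measurable φ)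
    (hφ0 : ∀ y, 0 ≤ φ y) (hint : Integrable fun y => φ y * G y) :
    Integrable (fun x => φ (T x) * F x) ∧ ∫ x, φ (T x) * F x = ∫ y, φ y * G y := by
  refine integrable_and_integral_eq_of_lintegral_eq ((hφ.comp h.measurable).mul hF)
    (fun x => mul_nonneg (hφ0 _) (hF0 x)) (integral_nonneg fun y => mul_nonneg (hφ0 y) (hG0 y)) ?_
  rw [ofReal_integral_eq_lintegral_ofReal hint
    (Eventually.of_forall fun y => mul_nonneg (hφ0 y) (hG0 y))]
  simp_rw [ENNReal.ofReal_mul (hφ0 _)]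
  exact h.lintegral_comp _ hφ.ennreal_ofReal

lemma natCast_mul_prod_rpow_le_sum {n : ℕ} (hn : 0 < n) {d : Fin n → ℝ} (hd : ∀ i, 0 ≤ d i) :
    (n : ℝ) * (∏ i, d i) ^ (1 / (n : ℝ)) ≤ ∑ i, d i := by
  have hN : (0 : ℝ) < n := by exact_mod_cast hn
  have h := geom_mean_le_arith_mean_weighted Finset.univ (fun _ => 1 / (n : ℝ)) d
    (fun i _ => by positivity) (by simp [hN.ne']) (fun i _ => hd i)
  rw [finsetProd_rpow _ _ (fun i _ => hd i), ← Finset.mul_sum] at h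
  calc (n : ℝ) * (∏ i, d i) ^ (1 / (n : ℝ)) ≤ n * (1 / n * ∑ i, d i) := by gcongr
    _ = ∑ i, d i := by field_simp

lemma sobolevConst_eq {n : ℕ} (hn : 3 ≤ n) :
    sobolevConst n = n * ((n : ℝ) - 2) * bubbleMass n ^ (2 / (n : ℝ)) := by
  have hN : (3 : ℝ) ≤ n := by exact_mod_cast hn
  have h1 := Gamma_pos_of_pos (show (0 : ℝ) < n / 2 by linarith)
  have h2 := Gamma_pos_of_pos (show (0 : ℝ) < n by linarith)
  rw [sobolevConst, bubbleMass, mul_div_assoc, mul_rpow (by positivity) (by positivity),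
    ← rpow_mul pi_pos.le, show (n : ℝ) / 2 * (2 / n) = 1 by field_simp, rpow_one]
  ring

/-- The sharp Sobolev inequality for positive functions with tame decay, in coordinates. -/
theorem sobolev_of_pos {n : ℕ} (hn : 3 ≤ n) {f : (Fin n → ℝ) → ℝ}
    {f' : Fin n → (Fin n → ℝ) → ℝ} (hf0 : ∀ x, 0 < f x) (hfc : Continuous f)
    (hF : TameDensity fun x => f x ^ (2 * (n : ℝ) / (n - 2))) (hf' : ∀ i, Measurable (f' i))
    (hd : ∀ i x, x ≠ 0 → HasDerivAt (fun t => f (Function.update x i t)) (f' i x) (x i))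
    (hint : Integrable fun x => ∑ i, f' i x ^ 2) :
    sobolevConst n * (∫ x, f x ^ (2 * (n : ℝ) / (n - 2))) ^ (((n : ℝ) - 2) / n) ≤
      ∫ x, ∑ i, f' i x ^ 2 := by
  obtain ⟨m, rfl⟩ : ∃ m, n = m + 1 := ⟨n - 1, by omega⟩
  rw [sobolevConst_eq hn]
  have hI := bubbleMass_pos hn
  set I := bubbleMass (m + 1)
  set N : ℝ := ((m + 1 : ℕ) : ℝ) with hNdef
  have hN : (3 : ℝ) ≤ N := by rw [hNdef]; exact_mod_cast hn
  have hN2 : 0 < N - 2 := by linarith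
  set p : ℝ := 2 * N / (N - 2) with hp
  set c : ℝ := 2 * (N - 1) / (N - 2) with hc
  have hc0 : 0 < c := div_pos (by linarith) hN2
  set F : (Fin (m + 1) → ℝ) → ℝ := fun x => f x ^ p with hFdef
  set M : ℝ := ∫ x, F x
  have hM : 0 < M := by
    rw [integral_pos_iff_support_of_nonneg (fun t => (hF.pos t).le) hF.integrable]
    have : Function.support F = Set.univ := by
      ext t; simpa using (hF.pos t).ne'
    simp [this]
  set l : ℝ := M / I with hl
  have hl0 : 0 < l := by positivity
  have hG := tameDensity_bubble (n := m + 1) hl0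
  rw [← hNdef] at hG
  set G : (Fin (m + 1) → ℝ) → ℝ := fun y => l * (1 + ∑ i, y i ^ 2) ^ (-N) with hGdef
  obtain ⟨T, D, hT⟩ := exists_isTriangularTransport hF hG (by
    rw [integral_const_mul, (integral_bubble hn).2]
    exact (div_mul_cancel₀ M hI.ne').symm)
  -- the two moments of the target
  have hs : ∀ y : Fin (m + 1) → ℝ, 0 < 1 + ∑ i, y i ^ 2 := fun y => by positivity
  have hmom := hT.integral_comp hF.continuous.measurable (fun x => (hF.pos x).le)
    (fun x => (hG.pos x).le) (φ := fun y => ∑ i, y i ^ 2) (by fun_prop) (fun y => by positivity)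
    (by
      refine ((integral_sum_sq_mul_bubble hn).1.const_mul l).congr (Eventually.of_forall fun y => ?_)
      simp only [hGdef]; ring)
  have hmom2 : ∫ x, (∑ i, T x i ^ 2) * F x = l * (N / (N - 2) * I) := by
    rw [hmom.2, ← (integral_sum_sq_mul_bubble hn).2, ← integral_const_mul]
    congr 1; ext y; simp only [hGdef]; ring
  have hφG : (fun y : Fin (m + 1) → ℝ => (l ^ (-(1 / N)) * (1 + ∑ i, y i ^ 2)) * G y) =
      fun y => l ^ (1 - 1 / N) * (1 + ∑ i, y i ^ 2) ^ (-(N - 1)) := by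
    ext y
    rw [hGdef, show -(N - 1) = -N + 1 by ring, rpow_add_one (hs y).ne',
      show 1 - 1 / N = -(1 / N) + 1 by ring, rpow_add_one hl0.ne']
    ring
  have hent := hT.integral_comp hF.continuous.measurable (fun x => (hF.pos x).le)
    (fun x => (hG.pos x).le) (φ := fun y => l ^ (-(1 / N)) * (1 + ∑ i, y i ^ 2)) (by fun_prop)
    (fun y => by have := hs y; positivity)
    (by rw [hφG]; exact (integral_bubble_sub_one hn).1.const_mul _)
  have hent2 : ∫ x, l ^ (-(1 / N)) * (1 + ∑ i, T x i ^ 2) * F x = l ^ (1 - 1 / N) * (c * I) := by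
    rw [hent.2, hφG, integral_const_mul, (integral_bubble_sub_one hn).2]
  -- the vector field
  set q : (Fin (m + 1) → ℝ) → ℝ := fun x => f x ^ c with hq
  set q' : Fin (m + 1) → (Fin (m + 1) → ℝ) → ℝ := fun i x => f' i x * c * f x ^ (c - 1) with hq'
  have hqF : ∀ x, q x = F x ^ (1 - 1 / N) := fun x => by
    rw [hq, hFdef, ← rpow_mul (hf0 x).le]
    rw [hp, hc]; field_simp
  have hfF : ∀ x, (f x ^ (c - 1)) ^ 2 = F x := fun x => by
    rw [← rpow_natCast, ← rpow_mul (hf0 x).le]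
    congr 1
    rw [hp, hc]; push_cast; field_simp; ring
  have hqm : Measurable q := hfc.measurable.pow_const c
  have hq'm : ∀ i, Measurable (q' i) := fun i =>
    ((hf' i).mul_const c).mul (hfc.measurable.pow_const _)
  have hTm : ∀ i, Measurable fun x => T x i := fun i => (measurable_pi_apply i).comp hT.measurable
  have hyoung : ∀ t, 0 < t → ∀ i x, |q' i x * T x i| ≤
      c / 2 * (t * f' i x ^ 2 + t⁻¹ * (T x i ^ 2 * F x)) := fun t ht i x => by
    rw [hq', abs_le, ← hfF x]
    have e : ∀ b : ℝ, c / 2 * (t * f' i x ^ 2 + t⁻¹ * (T x i ^ 2 * b ^ 2)) =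
        c / 2 * t⁻¹ * (t * f' i x - b * T x i) ^ 2 + f' i x * c * b * T x i := fun b => by
      field_simp; ring
    have e' : ∀ b : ℝ, c / 2 * (t * f' i x ^ 2 + t⁻¹ * (T x i ^ 2 * b ^ 2)) =
        c / 2 * t⁻¹ * (t * f' i x + b * T x i) ^ 2 - f' i x * c * b * T x i := fun b => by
      field_simp; ring
    have hp : ∀ b : ℝ, 0 ≤ c / 2 * t⁻¹ * b ^ 2 := fun b => by positivity
    constructor
    · rw [e']; linarith [hp (t * f' i x + f x ^ (c - 1) * T x i)]
    · rw [e]; linarith [hp (t * f' i x - f x ^ (c - 1) * T x i)]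
  have hTF : ∀ i, Integrable fun x => T x i ^ 2 * F x := fun i => by
    refine hmom.1.mono' (((hTm i).pow_const 2).mul hF.continuous.measurable).aestronglyMeasurable
      (Eventually.of_forall fun x => ?_)
    rw [norm_of_nonneg (mul_nonneg (sq_nonneg _) (hF.pos x).le)]
    exact mul_le_mul_of_nonneg_right (Finset.single_le_sum (f := fun i => T x i ^ 2)
      (fun j _ => sq_nonneg _) (Finset.mem_univ i)) (hF.pos x).le
  have hfi : ∀ i, Integrable fun x => f' i x ^ 2 := fun i => by
    refine hint.mono' ((hf' i).pow_const 2).aestronglyMeasurable (Eventually.of_forall fun x => ?_)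
    rw [norm_of_nonneg (sq_nonneg _)]
    exact Finset.single_le_sum (f := fun i => f' i x ^ 2) (fun j _ => sq_nonneg _)
      (Finset.mem_univ i)
  have hqT : ∀ i, Integrable fun x => q' i x * T x i := fun i =>
    ((((hfi i).const_mul 1).add ((hTF i).const_mul 1⁻¹)).const_mul (c / 2)).mono'
      ((hq'm i).mul (hTm i)).aestronglyMeasurable (Eventually.of_forall (hyoung 1 one_pos i))
  have hneg : ∀ i, Integrable fun x => -(q' i x * T x i) := fun i => (hqT i).neg
  have hsq : ∀ i, Integrable fun x => (q x * T x i) ^ 2 := fun i => by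
    obtain ⟨C, hC0, hC⟩ := hF.exists_bound
    refine ((hTF i).const_mul (C ^ (1 - 2 / N))).mono'
      ((hqm.mul (hTm i)).pow_const 2).aestronglyMeasurable (Eventually.of_forall fun x => ?_)
    have hFC : F x ≤ C :=
      (hC x).trans (mul_le_of_le_one_right hC0.le (prod_inv_one_add_sq_le_one x))
    have h1 : q x ^ 2 = F x ^ (1 - 2 / N) * F x := by
      rw [hqF, ← rpow_natCast, ← rpow_mul (hF.pos x).le, ← rpow_add_one (hF.pos x).ne']
      congr 1; push_cast; ring
    rw [norm_of_nonneg (sq_nonneg _), mul_pow, h1]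
    have h2 : F x ^ (1 - 2 / N) ≤ C ^ (1 - 2 / N) :=
      rpow_le_rpow (hF.pos x).le hFC (sub_nonneg.2 ((div_le_one (by linarith)).2 (by linarith)))
    calc F x ^ (1 - 2 / N) * F x * T x i ^ 2 = F x ^ (1 - 2 / N) * (T x i ^ 2 * F x) := by ring
      _ ≤ C ^ (1 - 2 / N) * (T x i ^ 2 * F x) :=
        mul_le_mul_of_nonneg_right h2 (mul_nonneg (sq_nonneg _) (hF.pos x).le)
  have hibp := fun i => hT.integral_mul_diag (by omega) i hqm (fun x => (rpow_pos_of_pos (hf0 x) _).le)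
    (fun x hx => by
      have := (hd i x hx).rpow_const (p := c) (Or.inl (hf0 _).ne')
      simpa [hq', hq] using this) (hqT i) (hsq i)
  -- arithmetic-geometric mean inequality
  have hamgm : ∀ x, N * (l ^ (-(1 / N)) * (1 + ∑ i, T x i ^ 2) * F x) ≤ ∑ i, q x * D x i :=
    fun x => by
    have h1 := natCast_mul_prod_rpow_le_sum (Nat.succ_pos m) fun i => (hT.diag_pos x i).le
    have hFx := hF.pos x
    have h2 : l ^ (-(1 / N)) * (1 + ∑ i, T x i ^ 2) = G (T x) ^ (-(1 / N)) := by
      rw [hGdef, mul_rpow hl0.le (rpow_pos_of_pos (hs _) _).le, ← rpow_mul (hs _).le,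
        show -N * -(1 / N) = 1 by field_simp, rpow_one]
    have h3 : G (T x) ^ (-(1 / N)) * F x = q x * (∏ i, D x i) ^ (1 / N) := by
      have h4 : ∏ i, D x i = F x / G (T x) := by
        rw [eq_div_iff (hG.pos _).ne', mul_comm]; exact (hT.eq_mul_prod x).symm
      rw [h4, hqF, div_rpow hFx.le (hG.pos _).le, rpow_neg (hG.pos _).le, rpow_sub hFx, rpow_one]
      have := rpow_pos_of_pos hFx (1 / N)
      field_simp
    rw [h2, h3, ← Finset.mul_sum]
    calc N * (q x * (∏ i, D x i) ^ (1 / N)) = q x * (N * (∏ i, D x i) ^ (1 / N)) := by ring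
      _ ≤ q x * ∑ i, D x i := mul_le_mul_of_nonneg_left h1 (rpow_pos_of_pos (hf0 x) _).le
  set K := ∫ x, ∑ i, f' i x ^ 2
  have hmain : ∀ t, 0 < t → N * (l ^ (1 - 1 / N) * (c * I)) ≤
      c / 2 * (t * K + t⁻¹ * (l * (N / (N - 2) * I))) := fun t ht => by
    calc N * (l ^ (1 - 1 / N) * (c * I))
        = ∫ x, N * (l ^ (-(1 / N)) * (1 + ∑ i, T x i ^ 2) * F x) := by
          rw [integral_const_mul, hent2]
      _ ≤ ∫ x, ∑ i, q x * D x i := integral_mono (hent.1.const_mul N)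
          (integrable_finsetSum _ fun i _ => (hibp i).1) hamgm
      _ = ∫ x, ∑ i, -(q' i x * T x i) := by
          rw [integral_finsetSum _ fun i _ => (hibp i).1,
            integral_finsetSum _ fun i _ => hneg i]
          exact Finset.sum_congr rfl fun i _ => by rw [(hibp i).2, integral_neg]
      _ ≤ ∫ x, c / 2 * (t * ∑ i, f' i x ^ 2 + t⁻¹ * ((∑ i, T x i ^ 2) * F x)) := by
          refine integral_mono (integrable_finsetSum _ fun i _ => hneg i)
            (((hint.const_mul t).add (hmom.1.const_mul t⁻¹)).const_mul _) fun x => ?_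
          simp only [Finset.mul_sum, Finset.sum_mul, ← Finset.sum_add_distrib]
          refine Finset.sum_le_sum fun i _ => (neg_le_abs _).trans ?_
          exact hyoung t ht i x
      _ = _ := by
          rw [integral_const_mul, integral_add (hint.const_mul t) (hmom.1.const_mul t⁻¹),
            integral_const_mul, integral_const_mul, hmom2]
  have hfin := hmain (l ^ (1 / N) / (N - 2)) (by positivity)
  have hL := rpow_pos_of_pos hl0 (1 / N)
  have e1 : l ^ (1 - 1 / N) = l / l ^ (1 / N) := by rw [rpow_sub hl0, rpow_one]
  rw [e1] at hfin
  set L := l ^ (1 / N) with hLdef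
  have e2 : N * (N - 2) * I * (l / L ^ 2) ≤ K := by
    have h1 : c / 2 * (L / (N - 2) * K + (L / (N - 2))⁻¹ * (l * (N / (N - 2) * I))) =
        c / 2 * (L / (N - 2)) * K + N * (l / L * (c * I)) / 2 := by
      field_simp
    have h2 : N * (l / L * (c * I)) = c * (L / (N - 2)) * (N * (N - 2) * I * (l / L ^ 2)) := by
      field_simp
    rw [h1] at hfin
    have h3 : c * (L / (N - 2)) * (N * (N - 2) * I * (l / L ^ 2)) ≤ c * (L / (N - 2)) * K := by
      rw [← h2]; linarith
    exact le_of_mul_le_mul_left h3 (by positivity)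
  refine le_trans (le_of_eq ?_) e2
  have e3 : L ^ 2 = l ^ (2 / N) := by
    rw [hLdef, ← rpow_natCast, ← rpow_mul hl0.le]; congr 1; push_cast; ring
  have e4 : M = l * I := (div_mul_cancel₀ M hI.ne').symm
  rw [e3, e4, mul_rpow hl0.le hI.le, show (N - 2) / N = 1 - 2 / N by field_simp, rpow_sub hl0,
    rpow_sub hI, rpow_one, rpow_one]
  have := rpow_pos_of_pos hI (2 / N)
  field_simp

/-- The sharp Sobolev inequality for compactly supported functions which are smooth along the
coordinate axes away from the origin. -/
theorem sobolev_of_hasCompactSupport_pi {n : ℕ} (hn : 3 ≤ n) {f : (Fin n → ℝ) → ℝ}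
    {f' : Fin n → (Fin n → ℝ) → ℝ} (hfc : Continuous f) (hcs : HasCompactSupport f)
    (hf' : ∀ i, Measurable (f' i))
    (hd : ∀ i x, x ≠ 0 → HasDerivAt (fun t => f (Function.update x i t)) (f' i x) (x i))
    (hint : Integrable fun x => ∑ i, f' i x ^ 2) :
    sobolevConst n * (∫ x, |f x| ^ (2 * (n : ℝ) / (n - 2))) ^ (((n : ℝ) - 2) / n) ≤
      ∫ x, ∑ i, f' i x ^ 2 := by
  have hN : (3 : ℝ) ≤ n := by exact_mod_cast hn
  set N : ℝ := (n : ℝ) with hNdef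
  have hN2 : 0 < N - 2 := by linarith
  set p : ℝ := 2 * N / (N - 2) with hp
  have hp0 : 0 < p := div_pos (by linarith) hN2
  set r : (Fin n → ℝ) → ℝ := fun x => 1 + ∑ i, x i ^ 2 with hr
  have hr0 : ∀ x, 0 < r x := fun x => by simp only [hr]; positivity
  have hrc : Continuous r := by fun_prop
  set h : (Fin n → ℝ) → ℝ := fun x => r x ^ (-(N - 2) / 2) with hh
  have hh0 : ∀ x, 0 < h x := fun x => rpow_pos_of_pos (hr0 x) _
  have hhc : Continuous h := hrc.rpow_const fun x => Or.inl (hr0 x).ne'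
  set h' : Fin n → (Fin n → ℝ) → ℝ := fun i x => 2 * x i * (-(N - 2) / 2) * r x ^ (-(N - 2) / 2 - 1)
    with hh'
  have hh'm : ∀ i, Measurable (h' i) := fun i => by
    have := hrc.measurable.pow_const (-(N - 2) / 2 - 1)
    have h2 := measurable_pi_apply (X := fun _ : Fin n => ℝ) i
    exact ((h2.const_mul 2).mul_const _).mul this
  have hrd : ∀ i x, HasDerivAt (fun t => r (Function.update x i t)) (2 * x i) (x i) := fun i x => by
    have h1 : (fun t => r (Function.update x i t)) =
        fun t => t ^ 2 + (1 + ∑ j ∈ Finset.univ.erase i, x j ^ 2) := by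
      ext t
      simp only [hr]
      rw [← Finset.add_sum_erase _ _ (Finset.mem_univ i), Function.update_self,
        Finset.sum_congr rfl fun j hj => by rw [Function.update_of_ne (Finset.ne_of_mem_erase hj)]]
      ring
    rw [h1]
    simpa using (hasDerivAt_pow 2 (x i)).add_const (1 + ∑ j ∈ Finset.univ.erase i, x j ^ 2)
  have hhd : ∀ i x, HasDerivAt (fun t => h (Function.update x i t)) (h' i x) (x i) := fun i x => by
    refine ((hrd i x).rpow_const (p := -(N - 2) / 2) (Or.inl (hr0 _).ne')).congr_deriv ?_
    simp only [Function.update_eq_self, hh']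
  have hh's : (fun x => ∑ i, h' i x ^ 2) = fun x => (N - 2) ^ 2 * ((∑ i, x i ^ 2) * r x ^ (-N)) := by
    ext x
    have : (r x ^ (-(N - 2) / 2 - 1)) ^ 2 = r x ^ (-N) := by
      rw [← rpow_natCast, ← rpow_mul (hr0 x).le]; congr 1; push_cast; ring
    simp only [hh', mul_pow, this, Finset.mul_sum, Finset.sum_mul]
    exact Finset.sum_congr rfl fun i _ => by ring
  have hh'i : Integrable fun x => ∑ i, h' i x ^ 2 := by
    rw [hh's]; exact (integral_sum_sq_mul_bubble hn).1.const_mul _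
  have hhp : ∀ x, h x ^ p = r x ^ (-N) := fun x => by
    rw [← rpow_mul (hr0 x).le]; congr 1; rw [hp]; field_simp
  obtain ⟨M, hM⟩ : ∃ M, ∀ x, ‖f x / h x‖ ≤ M :=
    (hcs.mul_right (f' := fun x => (h x)⁻¹)).exists_bound_of_continuous
      (hfc.mul (hhc.inv₀ fun x => (hh0 x).ne'))
  have hfM : ∀ x, f x ^ 2 ≤ M ^ 2 * h x ^ 2 := fun x => by
    have h1 := hM x
    rw [norm_div, norm_of_nonneg (hh0 x).le, div_le_iff₀ (hh0 x)] at h1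
    rw [← mul_pow, ← sq_abs]
    exact pow_le_pow_left₀ (abs_nonneg _) h1 2
  set C := ∫ x, ∑ i, h' i x ^ 2
  have hC : 0 ≤ C := integral_nonneg fun x => by positivity
  have key : ∀ e, 0 < e → sobolevConst n * (∫ x, |f x| ^ p) ^ ((N - 2) / N) ≤
      (∫ x, ∑ i, f' i x ^ 2) + e * C := fun e he => by
    set F : (Fin n → ℝ) → ℝ := fun x => √(f x ^ 2 + e * h x ^ 2) with hF
    have hpos : ∀ x, 0 < f x ^ 2 + e * h x ^ 2 := fun x => by have := hh0 x; positivity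
    have hF0 : ∀ x, 0 < F x := fun x => sqrt_pos.2 (hpos x)
    have hFc : Continuous F := by fun_prop
    have hFd : ∀ i x, x ≠ 0 → HasDerivAt (fun t => F (Function.update x i t))
        ((f x * f' i x + e * (h x * h' i x)) / F x) (x i) := fun i x hx => by
      have h1 := (((hd i x hx).pow 2).add (((hhd i x).pow 2).const_mul e)).sqrt (by
        simpa using (hpos x).ne')
      refine h1.congr_deriv ?_
      simp only [Pi.add_apply, Pi.pow_apply, Function.update_eq_self, hF]
      have := (hF0 x).ne'
      simp only [hF] at this
      field_simp
      simp
      ring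
    have hle : ∀ x, ∑ i, ((f x * f' i x + e * (h x * h' i x)) / F x) ^ 2 ≤
        ∑ i, f' i x ^ 2 + e * ∑ i, h' i x ^ 2 := fun x => by
      rw [Finset.mul_sum, ← Finset.sum_add_distrib]
      refine Finset.sum_le_sum fun i _ => ?_
      rw [div_pow, div_le_iff₀ (pow_pos (hF0 x) 2), sq_sqrt (hpos x).le]
      nlinarith [mul_nonneg he.le (sq_nonneg (f x * h' i x - h x * f' i x))]
    have hm : ∀ i, Measurable fun x => (f x * f' i x + e * (h x * h' i x)) / F x := fun i =>
      ((hfc.measurable.mul (hf' i)).add ((hhc.measurable.mul (hh'm i)).const_mul e)).div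
        hFc.measurable
    have hsum := hint.add (hh'i.const_mul e)
    have hint' : Integrable fun x => ∑ i, ((f x * f' i x + e * (h x * h' i x)) / F x) ^ 2 := by
      refine hsum.mono' (Finset.measurable_sum _ fun i _ =>
        (hm i).pow_const 2).aestronglyMeasurable (Eventually.of_forall fun x => ?_)
      rw [norm_of_nonneg (by positivity)]
      exact hle x
    have htame : TameDensity fun x => F x ^ p := by
      refine ⟨hFc.rpow_const fun x => Or.inl (hF0 x).ne', fun x => rpow_pos_of_pos (hF0 x) _, ?_⟩
      obtain ⟨K, hK⟩ := (tameDensity_bubble (n := n) (c := √(M ^ 2 + e) ^ p) (by positivity)).bound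
      refine ⟨K, fun x => le_trans ?_ (hK x)⟩
      rw [← hNdef, ← hhp x, ← mul_rpow (sqrt_nonneg _) (hh0 x).le]
      refine rpow_le_rpow (hF0 x).le (sqrt_le_iff.2 ⟨mul_nonneg (sqrt_nonneg _) (hh0 x).le, ?_⟩) hp0.le
      rw [mul_pow, sq_sqrt (by positivity)]
      linarith [hfM x]
    have h1 := sobolev_of_pos hn hF0 hFc htame hm hFd hint'
    have hS : 0 ≤ sobolevConst n := by
      have := bubbleMass_pos hn
      rw [sobolevConst_eq hn, ← hNdef]
      positivity
    calc sobolevConst n * (∫ x, |f x| ^ p) ^ ((N - 2) / N)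
        ≤ sobolevConst n * (∫ x, F x ^ p) ^ ((N - 2) / N) := by
          refine mul_le_mul_of_nonneg_left (rpow_le_rpow (integral_nonneg fun x => by positivity)
            (integral_mono_of_nonneg (Eventually.of_forall fun x => by positivity) htame.integrable
              (Eventually.of_forall fun x => rpow_le_rpow (abs_nonneg _) ?_ hp0.le))
            (by positivity)) hS
          exact abs_le_sqrt (by have := hh0 x; nlinarith [mul_pos he (pow_pos this 2)])
      _ ≤ _ := h1
      _ ≤ ∫ x, (∑ i, f' i x ^ 2 + e * ∑ i, h' i x ^ 2) := integral_mono hint' hsum hle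
      _ = _ := by rw [integral_add hint (hh'i.const_mul e), integral_const_mul]
  refine le_of_forall_pos_le_add fun δ hδ => (key (δ / (C + 1)) (by positivity)).trans ?_
  have : δ / (C + 1) * C ≤ δ := by
    rw [div_mul_eq_mul_div, div_le_iff₀ (by positivity)]; nlinarith
  linarith

/-- The sharp Sobolev inequality for compactly supported functions differentiable away from the
origin. -/
theorem sobolev_of_hasCompactSupport {n : ℕ} (hn : 3 ≤ n) {f : EuclideanSpace ℝ (Fin n) → ℝ}
    (hfc : Continuous f) (hcs : HasCompactSupport f) (hd : ∀ x, x ≠ 0 → DifferentiableAt ℝ f x)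
    (hint : Integrable fun x => ‖fderiv ℝ f x‖ ^ 2) :
    sobolevConst n * (∫ x, |f x| ^ (2 * (n : ℝ) / (n - 2))) ^ (((n : ℝ) - 2) / n) ≤
      ∫ x, ‖fderiv ℝ f x‖ ^ 2 := by
  have hvp := (PiLp.volume_preserving_toLp (Fin n))
  have hme := (MeasurableEquiv.toLp 2 (Fin n → ℝ)).measurableEmbedding
  have hsq : ∀ x, ∑ i, (fderiv ℝ f x (EuclideanSpace.single i 1)) ^ 2 = ‖fderiv ℝ f x‖ ^ 2 :=
    fun x => by
    have h1 := (EuclideanSpace.basisFun (Fin n) ℝ).sum_sq_norm_inner_left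
      ((InnerProductSpace.toDual ℝ _).symm (fderiv ℝ f x))
    rw [LinearIsometryEquiv.norm_map] at h1
    simpa [InnerProductSpace.toDual_symm_apply] using h1
  have hcomp : ∀ g : EuclideanSpace ℝ (Fin n) → ℝ, ∫ x, g (WithLp.toLp 2 x) = ∫ x, g x :=
    fun g => hvp.integral_comp hme g
  have hm := PiLp.continuous_toLp 2 (fun _ : Fin n => ℝ)
  have := sobolev_of_hasCompactSupport_pi hn (f := fun x => f (WithLp.toLp 2 x))
    (f' := fun i x => fderiv ℝ f (WithLp.toLp 2 x) (EuclideanSpace.single i 1)) (hfc.comp hm)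
    (hcs.comp_homeomorph (PiLp.homeomorph 2 (fun _ : Fin n => ℝ)).symm)
    (fun i => (measurable_fderiv_apply_const ℝ f _).comp hm.measurable)
    (fun i x hx => by
      have h1 := (hd (WithLp.toLp 2 x) (by simpa using hx)).hasFDerivAt
      have h2 : HasDerivAt (fun t => WithLp.toLp 2 (Function.update x i t))
          (EuclideanSpace.single i (1 : ℝ)) (x i) := by
        have := (PiLp.continuousLinearEquiv 2 ℝ (fun _ : Fin n => ℝ)).symm.hasFDerivAt.comp_hasDerivAt
          (x i) (hasDerivAt_update x i (x i))
        exact this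
      refine HasFDerivAt.comp_hasDerivAt (x i) ?_ h2
      simpa using h1)
    (by simp_rw [hsq]; exact (hvp.integrable_comp_emb hme).2 hint)
  simp_rw [hsq] at this
  rwa [hcomp fun x => |f x| ^ (2 * (n : ℝ) / (n - 2)), hcomp fun x => ‖fderiv ℝ f x‖ ^ 2] at this

end

section

open Filter Topology Set

/-- Integration in polar coordinates of a function supported in the unit ball. -/
lemma lintegral_eq_lintegral_toSphere {n : ℕ} (hn : 1 ≤ n)
    {g : EuclideanSpace ℝ (Fin n) → ENNReal} (hg : Measurable g) (hg0 : ∀ x, 1 ≤ ‖x‖ → g x = 0) :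
    ∫⁻ x, g x = ∫⁻ ω, (∫⁻ r in Ioo (0 : ℝ) 1,
      ENNReal.ofReal (r ^ (n - 1)) * g (r • (ω : EuclideanSpace ℝ (Fin n))))
        ∂(volume : Measure (EuclideanSpace ℝ (Fin n))).toSphere := by
  have : Nonempty (Fin n) := ⟨⟨0, hn⟩⟩
  have hmp := (volume : Measure (EuclideanSpace ℝ (Fin n))).measurePreserving_homeomorphUnitSphereProd
  rw [finrank_euclideanSpace_fin] at hmp
  set k : Metric.sphere (0 : EuclideanSpace ℝ (Fin n)) 1 × Ioi (0 : ℝ) → ENNReal :=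
    fun z => g ((z.2 : ℝ) • (z.1 : EuclideanSpace ℝ (Fin n)))
  have hk : Measurable k := hg.comp (by fun_prop)
  have h1 : ∫⁻ x, g x = ∫⁻ x : ({0}ᶜ : Set (EuclideanSpace ℝ (Fin n))), g x
      ∂(volume.comap (Subtype.val)) := by
    rw [lintegral_subtype_comap (measurableSet_singleton _).compl, restrict_compl_singleton]
  have h2 : ∀ x : ({0}ᶜ : Set (EuclideanSpace ℝ (Fin n))),
      g x = k (homeomorphUnitSphereProd (EuclideanSpace ℝ (Fin n)) x) := fun x => by
    have : ‖(x : EuclideanSpace ℝ (Fin n))‖ ≠ 0 := norm_ne_zero_iff.2 x.2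
    simp [k, smul_smul, this]
  rw [h1, lintegral_congr h2, hmp.lintegral_comp hk, lintegral_prod _ hk.aemeasurable]
  refine lintegral_congr fun ω => ?_
  have hpow : Measurable fun r : Ioi (0 : ℝ) => ENNReal.ofReal ((r : ℝ) ^ (n - 1)) := by fun_prop
  have hkω : Measurable fun r => k (ω, r) := hk.comp measurable_prodMk_left
  rw [Measure.volumeIoiPow, lintegral_withDensity_eq_lintegral_mul  _ hpow hkω]
  simp only [Pi.mul_apply, k]
  rw [lintegral_subtype_comap measurableSet_Ioi
    (fun r : ℝ => ENNReal.ofReal (r ^ (n - 1)) * g (r • (ω : EuclideanSpace ℝ (Fin n)))),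
    ← Ioo_union_Ici_eq_Ioi (zero_lt_one' ℝ), lintegral_union measurableSet_Ici
      (disjoint_left.2 fun x hx hx' => not_lt.2 hx' hx.2)]
  have h0 : ∫⁻ r in Ici (1 : ℝ),
      ENNReal.ofReal (r ^ (n - 1)) * g (r • (ω : EuclideanSpace ℝ (Fin n))) = 0 := by
    rw [setLIntegral_congr_fun (g := fun _ => 0) measurableSet_Ici, lintegral_zero]
    intro r hr
    have hr' : (1 : ℝ) ≤ r := hr
    have : ‖(ω : EuclideanSpace ℝ (Fin n))‖ = 1 := by simp
    simp [hg0 (r • (ω : EuclideanSpace ℝ (Fin n)))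
      (by rw [norm_smul, this, mul_one]; exact hr'.trans (le_abs_self r))]
  rw [h0, add_zero]

/-- The radial change of variables which turns logarithmic weights into powers. -/
noncomputable def logRadius (a ρ : ℝ) : ℝ := exp (a - a * ρ ^ (-1 / a))

lemma logRadius_pos (a ρ : ℝ) : 0 < logRadius a ρ := exp_pos _

lemma logRadius_one (a : ℝ) : logRadius a 1 = 1 := by simp [logRadius]

lemma X1_logRadius {a ρ : ℝ} (hρ : 0 < ρ) : X1 a (logRadius a ρ) = ρ ^ (1 / a) / a := by
  rw [X1, logRadius, log_exp, neg_div, rpow_neg hρ.le]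
  have := (rpow_pos_of_pos hρ (1 / a)).ne'
  by_cases ha : a = 0
  · simp [ha]
  · field_simp; ring

lemma hasDerivAt_logRadius {a ρ : ℝ} (ha : 0 < a) (hρ : 0 < ρ) :
    HasDerivAt (logRadius a) (logRadius a ρ * ρ ^ (-1 / a - 1)) ρ := by
  have h := (((hasDerivAt_rpow_const (p := -1 / a) (Or.inl hρ.ne')).const_mul a).const_sub a).exp
  refine h.congr_deriv ?_
  rw [logRadius]; field_simp

lemma logRadius_strictMonoOn {a : ℝ} (ha : 0 < a) : StrictMonoOn (logRadius a) (Ioi 0) :=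
  fun x hx y _ hxy => by
    have := rpow_lt_rpow_of_neg hx hxy (div_neg_of_neg_of_pos neg_one_lt_zero ha)
    exact exp_lt_exp.2 (by nlinarith)

lemma one_le_logRadius {a ρ : ℝ} (ha : 0 < a) (hρ : 1 ≤ ρ) : 1 ≤ logRadius a ρ := by
  rw [← logRadius_one a]
  exact (logRadius_strictMonoOn ha).monotoneOn (zero_lt_one' ℝ) (zero_lt_one.trans_le hρ) hρ

lemma logRadius_image_Ioo {a : ℝ} (ha : 0 < a) : logRadius a '' Ioo 0 1 = Ioo 0 1 := by
  ext r
  constructor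
  · rintro ⟨ρ, hρ, rfl⟩
    refine ⟨logRadius_pos a ρ, ?_⟩
    rw [← logRadius_one a]
    exact logRadius_strictMonoOn ha hρ.1 (zero_lt_one' ℝ) hρ.2
  · rintro ⟨h0, h1⟩
    have hl := log_neg h0 h1
    have h2 : 1 < 1 - log r / a := by
      have := div_neg_of_neg_of_pos hl ha
      linarith
    have h3 : 0 < 1 - log r / a := by linarith
    refine ⟨(1 - log r / a) ^ (-a), ⟨rpow_pos_of_pos h3 _,
      rpow_lt_one_of_one_lt_of_neg h2 (by linarith)⟩, ?_⟩
    rw [logRadius, ← rpow_mul h3.le, show -a * (-1 / a) = 1 by field_simp, rpow_one]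
    rw [show a - a * (1 - log r / a) = log r by field_simp; ring, exp_log h0]

lemma lintegral_comp_logRadius {a : ℝ} (ha : 0 < a) (k : ℝ → ENNReal) :
    ∫⁻ ρ in Ioo (0 : ℝ) 1, ENNReal.ofReal (logRadius a ρ * ρ ^ (-1 / a - 1)) * k (logRadius a ρ) =
      ∫⁻ r in Ioo (0 : ℝ) 1, k r := by
  have h := lintegral_image_eq_lintegral_abs_deriv_mul measurableSet_Ioo
    (fun ρ hρ => (hasDerivAt_logRadius ha hρ.1).hasDerivWithinAt)
    ((logRadius_strictMonoOn ha).injOn.mono fun ρ (hρ : ρ ∈ Ioo (0 : ℝ) 1) => hρ.1) k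
  rw [logRadius_image_Ioo ha] at h
  rw [h]
  refine setLIntegral_congr_fun measurableSet_Ioo fun ρ hρ => ?_
  rw [abs_of_nonneg (mul_pos (logRadius_pos a ρ) (rpow_pos_of_pos hρ.1 _)).le]

lemma hasFDerivAt_norm_smul_of_norm_eq_one {E : Type*} [NormedAddCommGroup E]
    [InnerProductSpace ℝ E] {ω : E} {ρ : ℝ} (hω : ‖ω‖ = 1) (hρ : 0 < ρ) :
    HasFDerivAt (fun y : E => ‖y‖) (innerSL ℝ ω) (ρ • ω) := by
  have hn : ‖ρ • ω‖ = ρ := by rw [norm_smul, hω, mul_one, norm_of_nonneg hρ.le]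
  have h := (hasStrictFDerivAt_norm_sq (ρ • ω)).hasFDerivAt.sqrt (by rw [hn]; positivity)
  simp only [sqrt_sq (norm_nonneg _)] at h
  refine h.congr_fderiv ?_
  ext z
  rw [hn]
  simp
  field_simp

lemma hasGradientAt_radial {E : Type*} [NormedAddCommGroup E] [InnerProductSpace ℝ E]
    [CompleteSpace E] {v : E → ℝ} {A γ : ℝ → ℝ} {A' γ' ρ : ℝ} {ω G : E} (hω : ‖ω‖ = 1)
    (hρ : 0 < ρ) (hA : HasDerivAt A A' ρ) (hγ : HasDerivAt γ γ' ρ)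
    (hv : HasGradientAt v G ((γ ρ * ρ) • ω)) :
    HasGradientAt (fun y => A ‖y‖ * v (γ ‖y‖ • y))
      ((A' * v ((γ ρ * ρ) • ω) + A ρ * γ' * ρ * inner ℝ ω G) • ω + (A ρ * γ ρ) • G) (ρ • ω) := by
  have hn : ‖ρ • ω‖ = ρ := by rw [norm_smul, hω, mul_one, norm_of_nonneg hρ.le]
  have h0 := hasFDerivAt_norm_smul_of_norm_eq_one hω hρ
  have hA' := HasDerivAt.comp_hasFDerivAt (ρ • ω) (by rwa [hn]) h0 (h₂ := A) (h₂' := A')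
  have hγ' := HasDerivAt.comp_hasFDerivAt (ρ • ω) (by rwa [hn]) h0 (h₂ := γ) (h₂' := γ')
  have h1 := hγ'.smul (hasFDerivAt_id (ρ • ω))
  have hv' : HasFDerivAt v (InnerProductSpace.toDual ℝ E G) (γ ‖ρ • ω‖ • (ρ • ω)) := by
    rw [hn, smul_smul]; exact hv.hasFDerivAt
  have h2 := hA'.mul (HasFDerivAt.comp (ρ • ω) (f := fun y : E => γ ‖y‖ • y) hv' h1)
  rw [hasGradientAt_iff_hasFDerivAt]
  refine h2.congr_fderiv ?_
  ext z
  simp [hn, smul_smul, real_inner_comm ω G]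
  ring

lemma norm_smul_add_smul_sq {E : Type*} [NormedAddCommGroup E] [InnerProductSpace ℝ E]
    {ω G : E} (hω : ‖ω‖ = 1) (c d : ℝ) :
    ‖c • ω + d • G‖ ^ 2 =
      (c + d * inner ℝ ω G) ^ 2 + d ^ 2 * (‖G‖ ^ 2 - inner ℝ ω G ^ 2) := by
  rw [norm_add_sq_real, norm_smul, norm_smul, hω, inner_smul_left, inner_smul_right, mul_pow,
    mul_pow, norm_eq_abs, norm_eq_abs, sq_abs, sq_abs]
  simp only [conj_trivial]
  ring

/-- The function `‖y‖ ^ β * v (Φ y)` where `Φ` is the radial map with profile `logRadius a`. -/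
noncomputable def logSubst {n : ℕ} (a β : ℝ) (v : EuclideanSpace ℝ (Fin n) → ℝ)
    (y : EuclideanSpace ℝ (Fin n)) : ℝ :=
  ‖y‖ ^ β * v ((logRadius a ‖y‖ / ‖y‖) • y)

section
variable {n : ℕ} {a β : ℝ} {v : EuclideanSpace ℝ (Fin n) → ℝ}

lemma logSubst_smul {ω : EuclideanSpace ℝ (Fin n)} (hω : ‖ω‖ = 1) {ρ : ℝ} (hρ : 0 < ρ) :
    logSubst a β v (ρ • ω) = ρ ^ β * v (logRadius a ρ • ω) := by
  have hn : ‖ρ • ω‖ = ρ := by rw [norm_smul, hω, mul_one, norm_of_nonneg hρ.le]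
  rw [logSubst, hn, smul_smul, div_mul_cancel₀ _ hρ.ne']

lemma hasGradientAt_logSubst (ha : 0 < a) (hv : Differentiable ℝ v)
    {ω : EuclideanSpace ℝ (Fin n)} (hω : ‖ω‖ = 1) {ρ : ℝ} (hρ : 0 < ρ) :
    ∃ g, HasGradientAt (logSubst a β v) g (ρ • ω) ∧
      ‖g‖ ^ 2 = (β * ρ ^ (β - 1) * v (logRadius a ρ • ω) + ρ ^ β * (logRadius a ρ * ρ ^ (-1 / a - 1))
          * inner ℝ ω (gradient v (logRadius a ρ • ω))) ^ 2 +
        (ρ ^ β * (logRadius a ρ / ρ)) ^ 2 * (‖gradient v (logRadius a ρ • ω)‖ ^ 2 -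
          inner ℝ ω (gradient v (logRadius a ρ • ω)) ^ 2) := by
  have hc : logRadius a ρ / ρ * ρ = logRadius a ρ := div_mul_cancel₀ _ hρ.ne'
  have h := hasGradientAt_radial hω hρ (hasDerivAt_rpow_const (p := β) (Or.inl hρ.ne'))
    ((hasDerivAt_logRadius ha hρ).div (hasDerivAt_id ρ) hρ.ne')
    (hv _).hasGradientAt
  refine ⟨_, h, ?_⟩
  simp only [Pi.div_apply, id, hc]
  rw [norm_smul_add_smul_sq hω]
  congr 2
  field_simp
  ring

lemma logSubst_eq_zero (ha : 0 < a) (hv : ∀ x, 1 ≤ ‖x‖ → v x = 0)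
    {y : EuclideanSpace ℝ (Fin n)} (hy : 1 ≤ ‖y‖) : logSubst a β v y = 0 := by
  rw [logSubst, hv, mul_zero]
  rw [norm_smul, norm_div, norm_norm, div_mul_cancel₀ _ (by linarith),
    norm_of_nonneg (logRadius_pos _ _).le]
  exact one_le_logRadius ha hy

lemma differentiableAt_logSubst (ha : 0 < a) (hv : Differentiable ℝ v)
    {y : EuclideanSpace ℝ (Fin n)} (hy : y ≠ 0) : DifferentiableAt ℝ (logSubst a β v) y := by
  have hy' := norm_pos_iff.2 hy
  obtain ⟨g, hg, -⟩ := hasGradientAt_logSubst (β := β) ha hv (ω := ‖y‖⁻¹ • y)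
    (by rw [norm_smul, norm_inv, norm_norm, inv_mul_cancel₀ hy'.ne']) hy'
  rw [smul_smul, mul_inv_cancel₀ hy'.ne', one_smul] at hg
  exact hg.differentiableAt

lemma continuous_logSubst (ha : 0 < a) (hβ : 0 < β) (hv : Differentiable ℝ v)
    (hcs : HasCompactSupport v) : Continuous (logSubst a β v) := by
  obtain ⟨C, hC⟩ := hcs.exists_bound_of_continuous hv.continuous
  refine continuous_iff_continuousAt.2 fun y => ?_
  by_cases hy : y = 0
  · subst hy
    have h0 : logSubst a β v 0 = 0 := by simp [logSubst, zero_rpow hβ.ne']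
    rw [ContinuousAt, h0]
    refine squeeze_zero_norm (a := fun y => ‖y‖ ^ β * C) (fun y => ?_) ?_
    · rw [logSubst, norm_mul, norm_of_nonneg (by positivity : 0 ≤ ‖y‖ ^ β)]
      exact mul_le_mul_of_nonneg_left (hC _) (by positivity)
    · have : Continuous fun y : EuclideanSpace ℝ (Fin n) => ‖y‖ ^ β * C :=
        (continuous_norm.rpow_const fun _ => Or.inr hβ.le).mul continuous_const
      simpa [zero_rpow hβ.ne'] using this.tendsto 0
  · exact (differentiableAt_logSubst ha hv hy).continuousAt

lemma hasCompactSupport_logSubst (ha : 0 < a) (hv : ∀ x, 1 ≤ ‖x‖ → v x = 0) :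
    HasCompactSupport (logSubst a β v) := by
  refine HasCompactSupport.intro (isCompact_closedBall 0 1) fun y hy => logSubst_eq_zero ha hv ?_
  simpa using (not_le.1 fun h => hy (by simpa using h)).le

end

section
variable {n : ℕ} {a β : ℝ} {v : EuclideanSpace ℝ (Fin n) → ℝ}

lemma gradient_logSubst_eq_zero (ha : 0 < a) (hv : Differentiable ℝ v)
    (hv0 : ∀ x, 1 ≤ ‖x‖ → v x = 0) (hv1 : ∀ x, 1 ≤ ‖x‖ → gradient v x = 0)
    {y : EuclideanSpace ℝ (Fin n)} (hy : 1 ≤ ‖y‖) : gradient (logSubst a β v) y = 0 := by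
  have hy' : 0 < ‖y‖ := by linarith
  have hω : ‖‖y‖⁻¹ • y‖ = 1 := by rw [norm_smul, norm_inv, norm_norm, inv_mul_cancel₀ hy'.ne']
  obtain ⟨g, hg, hn⟩ := hasGradientAt_logSubst (β := β) ha hv hω hy'
  have h1 : 1 ≤ ‖logRadius a ‖y‖ • ‖y‖⁻¹ • y‖ := by
    rw [norm_smul, hω, mul_one, norm_of_nonneg (logRadius_pos _ _).le]
    exact one_le_logRadius ha hy
  rw [smul_smul ‖y‖, mul_inv_cancel₀ hy'.ne', one_smul] at hg
  rw [hv0 _ h1, hv1 _ h1] at hn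
  rw [hg.gradient]
  simpa using hn

lemma hasDerivAt_comp_logRadius_smul (ha : 0 < a) (hv : Differentiable ℝ v)
    (ω : EuclideanSpace ℝ (Fin n)) {ρ : ℝ} (hρ : 0 < ρ) :
    HasDerivAt (fun ρ => v (logRadius a ρ • ω))
      (logRadius a ρ * ρ ^ (-1 / a - 1) * inner ℝ ω (gradient v (logRadius a ρ • ω))) ρ := by
  have h := (hv (logRadius a ρ • ω)).hasGradientAt.hasFDerivAt.comp_hasDerivAt ρ
    ((hasDerivAt_logRadius ha hρ).smul_const ω)
  refine h.congr_deriv ?_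
  rw [map_smul, InnerProductSpace.toDual_apply_apply, real_inner_comm, smul_eq_mul]

/-- The radial energy density of the substituted function is bounded by that of the original one
up to an exact derivative. -/
lemma pow_mul_norm_gradient_logSubst_sq_le (hn : 2 ≤ n) (ha : 0 < a) (hβ : 0 ≤ β)
    (hβa : (n : ℝ) - 2 + 2 * β = 1 / a) (hv : Differentiable ℝ v)
    {ω : EuclideanSpace ℝ (Fin n)} (hω : ‖ω‖ = 1) {ρ : ℝ} (hρ : 0 < ρ) (hρ1 : ρ ≤ 1) :
    ρ ^ (n - 1) * ‖gradient (logSubst a β v) (ρ • ω)‖ ^ 2 ≤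
      logRadius a ρ * ρ ^ (-1 / a - 1) *
          (logRadius a ρ * ‖gradient v (logRadius a ρ • ω)‖ ^ 2) +
        β * (1 / a * ρ ^ (1 / a - 1) * v (logRadius a ρ • ω) ^ 2 + ρ ^ (1 / a) *
          (2 * v (logRadius a ρ • ω) * (logRadius a ρ * ρ ^ (-1 / a - 1) *
            inner ℝ ω (gradient v (logRadius a ρ • ω))))) := by
  obtain ⟨g, hg, hgn⟩ := hasGradientAt_logSubst (β := β) ha hv hω hρ
  rw [hg.gradient, hgn]
  set r := logRadius a ρ
  set V := v (r • ω)
  set G := gradient v (r • ω)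
  set s : ℝ := inner ℝ ω G
  have hs : 0 ≤ ‖G‖ ^ 2 - s ^ 2 := by
    have h1 := abs_real_inner_le_norm ω G
    rw [hω, one_mul] at h1
    have h2 := pow_le_pow_left₀ (abs_nonneg _) h1 2
    rw [sq_abs] at h2
    linarith
  set t := ρ ^ (1 / a) with ht
  have ht0 : 0 < t := rpow_pos_of_pos hρ _
  have ht1 : t ≤ 1 := rpow_le_one hρ.le hρ1 (by positivity)
  have hβ' : β ≤ 1 / a := by
    have : (2 : ℝ) ≤ n := by exact_mod_cast hn
    linarith
  have e1 : ρ ^ (-1 / a - 1) = 1 / (t * ρ) := by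
    rw [rpow_sub_one hρ.ne', neg_div, rpow_neg hρ.le, ← ht]; field_simp
  have e2 : ρ ^ (1 / a - 1) = t / ρ := rpow_sub_one hρ.ne' _
  have e3 : ρ ^ (β - 1) = ρ ^ β / ρ := rpow_sub_one hρ.ne' _
  have e4 : ρ ^ (n - 1) * (ρ ^ β) ^ 2 = t * ρ := by
    rw [← rpow_natCast, ← rpow_natCast (ρ ^ β), ← rpow_mul hρ.le, ← rpow_add hρ, ht,
      ← rpow_add_one hρ.ne']
    congr 1
    rw [Nat.cast_sub (by omega)]
    push_cast
    linarith
  rw [e1, e2, e3]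
  have h1 : ρ ^ (n - 1) * ((β * (ρ ^ β / ρ) * V + ρ ^ β * (r * (1 / (t * ρ))) * s) ^ 2 +
      (ρ ^ β * (r / ρ)) ^ 2 * (‖G‖ ^ 2 - s ^ 2)) =
      (ρ ^ (n - 1) * (ρ ^ β) ^ 2) * ((β / ρ * V + (r * (1 / (t * ρ))) * s) ^ 2 +
        (r / ρ) ^ 2 * (‖G‖ ^ 2 - s ^ 2)) := by ring
  rw [h1, e4]
  have h2 : r * (1 / (t * ρ)) * (r * ‖G‖ ^ 2) +
      β * (1 / a * (t / ρ) * V ^ 2 + t * (2 * V * (r * (1 / (t * ρ)) * s))) -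
      t * ρ * ((β / ρ * V + (r * (1 / (t * ρ))) * s) ^ 2 + (r / ρ) ^ 2 * (‖G‖ ^ 2 - s ^ 2)) =
      ρ⁻¹ * (β * (1 / a - β) * t * V ^ 2 + r ^ 2 * (‖G‖ ^ 2 - s ^ 2) * ((1 - t ^ 2) / t)) := by
    field_simp
    ring
  have h3 : 0 ≤ ρ⁻¹ * (β * (1 / a - β) * t * V ^ 2 +
      r ^ 2 * (‖G‖ ^ 2 - s ^ 2) * ((1 - t ^ 2) / t)) := by
    have h4 : 0 ≤ 1 / a - β := by linarith
    have h5 : 0 ≤ 1 - t ^ 2 := by nlinarith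
    positivity
  linarith

lemma lintegral_pow_mul_norm_gradient_logSubst_le (hn : 2 ≤ n) (ha : 0 < a) (hβ : 0 ≤ β)
    (hβa : (n : ℝ) - 2 + 2 * β = 1 / a) (hv : ContDiff ℝ 1 v)
    (hv0 : ∀ x, 1 ≤ ‖x‖ → v x = 0) {ω : EuclideanSpace ℝ (Fin n)} (hω : ‖ω‖ = 1) :
    ∫⁻ ρ in Ioo (0 : ℝ) 1, ENNReal.ofReal (ρ ^ (n - 1)) *
        ENNReal.ofReal (‖gradient (logSubst a β v) (ρ • ω)‖ ^ 2) ≤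
      ∫⁻ r in Ioo (0 : ℝ) 1, ENNReal.ofReal (r * ‖gradient v (r • ω)‖ ^ 2) := by
  have hvd : Differentiable ℝ v := hv.differentiable one_ne_zero
  have hvg : Continuous (gradient v) :=
    (InnerProductSpace.toDual ℝ _).symm.continuous.comp (hv.continuous_fderiv one_ne_zero)
  rw [← lintegral_comp_logRadius ha fun r => ENNReal.ofReal (r * ‖gradient v (r • ω)‖ ^ 2)]
  set Q : ℝ → ℝ := fun ρ => logRadius a ρ * ρ ^ (-1 / a - 1) *
    (logRadius a ρ * ‖gradient v (logRadius a ρ • ω)‖ ^ 2) with hQ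
  set H : ℝ → ℝ := fun ρ => ρ ^ (1 / a) * v (logRadius a ρ • ω) ^ 2 with hH
  set H' : ℝ → ℝ := fun ρ => 1 / a * ρ ^ (1 / a - 1) * v (logRadius a ρ • ω) ^ 2 + ρ ^ (1 / a) *
    (2 * v (logRadius a ρ • ω) * (logRadius a ρ * ρ ^ (-1 / a - 1) *
      inner ℝ ω (gradient v (logRadius a ρ • ω)))) with hH'
  have hHd : ∀ ρ, 0 < ρ → HasDerivAt H (H' ρ) ρ := fun ρ hρ => by
    have h := (hasDerivAt_rpow_const (p := 1 / a) (Or.inl hρ.ne')).mul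
      ((hasDerivAt_comp_logRadius_smul ha hvd ω hρ).pow 2)
    refine h.congr_deriv ?_
    simp [hH']
  have hr : ContinuousOn (logRadius a) (Ioi 0) := fun ρ hρ =>
    (hasDerivAt_logRadius ha hρ).continuousAt.continuousWithinAt
  have hp : ∀ p : ℝ, ContinuousOn (fun ρ : ℝ => ρ ^ p) (Ioi 0) := fun p ρ hρ =>
    (continuousAt_rpow_const ρ p (Or.inl (ne_of_gt hρ))).continuousWithinAt
  have hrω : ContinuousOn (fun ρ => logRadius a ρ • ω) (Ioi 0) := hr.smul continuousOn_const
  have hvr : ContinuousOn (fun ρ => v (logRadius a ρ • ω)) (Ioi 0) :=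
    hv.continuous.comp_continuousOn hrω
  have hgr : ContinuousOn (fun ρ => gradient v (logRadius a ρ • ω)) (Ioi 0) :=
    hvg.comp_continuousOn hrω
  have hQc : ContinuousOn Q (Ioi 0) := (hr.mul (hp _)).mul (hr.mul (hgr.norm.pow 2))
  have hH'c : ContinuousOn H' (Ioi 0) :=
    ((continuousOn_const.mul (hp _)).mul (hvr.pow 2)).add
      ((hp _).mul ((continuousOn_const.mul hvr).mul
        ((hr.mul (hp _)).mul (continuousOn_const.inner hgr))))
  have hQ0 : ∀ ρ, 0 < ρ → 0 ≤ Q ρ := fun ρ hρ => by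
    have := logRadius_pos a ρ
    positivity
  have hQe : ∫⁻ ρ in Ioo (0 : ℝ) 1, ENNReal.ofReal (logRadius a ρ * ρ ^ (-1 / a - 1)) *
      ENNReal.ofReal (logRadius a ρ * ‖gradient v (logRadius a ρ • ω)‖ ^ 2) =
      ∫⁻ ρ in Ioo (0 : ℝ) 1, ENNReal.ofReal (Q ρ) :=
    setLIntegral_congr_fun measurableSet_Ioo fun ρ hρ =>
      (ENNReal.ofReal_mul (mul_pos (logRadius_pos a ρ) (rpow_pos_of_pos hρ.1 _)).le).symm
  rw [hQe]
  have hU : Ioo (0 : ℝ) 1 = ⋃ k : ℕ, Ioo (1 / ((k : ℝ) + 1)) 1 := by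
    ext x
    simp only [mem_iUnion, mem_Ioo]
    constructor
    · rintro ⟨h0, h1⟩
      obtain ⟨k, hk⟩ := exists_nat_one_div_lt h0
      exact ⟨k, hk, h1⟩
    · rintro ⟨k, hk, h1⟩
      exact ⟨lt_trans (by positivity) hk, h1⟩
  have hmono : Monotone fun k : ℕ => Ioo (1 / ((k : ℝ) + 1)) 1 := fun k l hkl =>
    Ioo_subset_Ioo_left (one_div_le_one_div_of_le (by positivity) (by
      have : (k : ℝ) ≤ l := by exact_mod_cast hkl
      linarith))
  conv_lhs => rw [hU]
  rw [setLIntegral_iUnion_of_directed _ hmono.directed_le]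
  refine iSup_le fun k => ?_
  set δ : ℝ := 1 / ((k : ℝ) + 1)
  have hδ : 0 < δ := by positivity
  have hδ1 : δ ≤ 1 := by
    rw [div_le_one (by positivity)]
    linarith [(Nat.cast_nonneg k : (0 : ℝ) ≤ k)]
  have hsub : Icc δ 1 ⊆ Ioi 0 := fun x hx => lt_of_lt_of_le hδ hx.1
  have hQi : IntervalIntegrable Q volume δ 1 :=
    (hQc.mono (by rwa [uIcc_of_le hδ1])).intervalIntegrable
  have hH'i : IntervalIntegrable H' volume δ 1 :=
    (hH'c.mono (by rwa [uIcc_of_le hδ1])).intervalIntegrable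
  have hsumi := hQi.add (hH'i.const_mul β)
  have hpt : ∀ ρ ∈ Ioo δ 1, ρ ^ (n - 1) * ‖gradient (logSubst a β v) (ρ • ω)‖ ^ 2 ≤
      Q ρ + β * H' ρ := fun ρ hρ =>
    pow_mul_norm_gradient_logSubst_sq_le hn ha hβ hβa hvd hω (hδ.trans hρ.1) hρ.2.le
  have hint : ∫ ρ in Ioo δ 1, (Q ρ + β * H' ρ) ≤ ∫ ρ in Ioo δ 1, Q ρ := by
    rw [← integral_Ioc_eq_integral_Ioo, ← integral_Ioc_eq_integral_Ioo,
      ← intervalIntegral.integral_of_le hδ1, ← intervalIntegral.integral_of_le hδ1,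
      intervalIntegral.integral_add hQi (hH'i.const_mul β), intervalIntegral.integral_const_mul,
      intervalIntegral.integral_eq_sub_of_hasDerivAt (fun ρ hρ => hHd ρ (by
        rw [uIcc_of_le hδ1] at hρ; exact hsub hρ)) hH'i]
    have h1 : H 1 = 0 := by simp [hH, logRadius_one, hv0 ω hω.ge]
    have h2 : 0 ≤ H δ := by positivity
    rw [h1]
    nlinarith
  have hion : ∀ {φ : ℝ → ℝ}, IntervalIntegrable φ volume δ 1 → IntegrableOn φ (Ioo δ 1) :=
    fun h => ((intervalIntegrable_iff_integrableOn_Ioc_of_le hδ1).1 h).mono_set Ioo_subset_Ioc_self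
  calc ∫⁻ ρ in Ioo δ 1, ENNReal.ofReal (ρ ^ (n - 1)) *
        ENNReal.ofReal (‖gradient (logSubst a β v) (ρ • ω)‖ ^ 2)
      ≤ ∫⁻ ρ in Ioo δ 1, ENNReal.ofReal (Q ρ + β * H' ρ) := by
        refine setLIntegral_mono' measurableSet_Ioo fun ρ hρ => ?_
        rw [← ENNReal.ofReal_mul (pow_nonneg (hδ.trans hρ.1).le _)]
        exact ENNReal.ofReal_le_ofReal (hpt ρ hρ)
    _ = ENNReal.ofReal (∫ ρ in Ioo δ 1, (Q ρ + β * H' ρ)) := by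
        refine (ofReal_integral_eq_lintegral_ofReal (hion hsumi) ?_).symm
        refine (ae_restrict_iff' measurableSet_Ioo).2 (Eventually.of_forall fun ρ hρ => ?_)
        have h1 := hδ.trans hρ.1
        exact le_trans (by positivity) (hpt ρ hρ)
    _ ≤ ENNReal.ofReal (∫ ρ in Ioo δ 1, Q ρ) := ENNReal.ofReal_le_ofReal hint
    _ = ∫⁻ ρ in Ioo δ 1, ENNReal.ofReal (Q ρ) := by
        refine ofReal_integral_eq_lintegral_ofReal (hion hQi) ?_
        exact (ae_restrict_iff' measurableSet_Ioo).2
          (Eventually.of_forall fun ρ hρ => hQ0 ρ (hδ.trans hρ.1))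
    _ ≤ ∫⁻ ρ in Ioo 0 1, ENNReal.ofReal (Q ρ) :=
        lintegral_mono_set (Ioo_subset_Ioo_left hδ.le)

end

lemma norm_gradient {E : Type*} [NormedAddCommGroup E] [InnerProductSpace ℝ E] [CompleteSpace E]
    (f : E → ℝ) (x : E) : ‖gradient f x‖ = ‖fderiv ℝ f x‖ :=
  LinearIsometryEquiv.norm_map _ _

section
variable {n : ℕ} {a β : ℝ} {v : EuclideanSpace ℝ (Fin n) → ℝ}

lemma lintegral_logSubst_rpow (hn : 3 ≤ n) (ha : 0 < a)
    (hβa : (n : ℝ) - 2 + 2 * β = 1 / a) {ω : EuclideanSpace ℝ (Fin n)} (hω : ‖ω‖ = 1) :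
    ∫⁻ ρ in Ioo (0 : ℝ) 1, ENNReal.ofReal (ρ ^ (n - 1)) *
        ENNReal.ofReal (|logSubst a β v (ρ • ω)| ^ (2 * (n : ℝ) / (n - 2))) =
      ENNReal.ofReal (a ^ (2 * ((n : ℝ) - 1) / (n - 2))) *
        ∫⁻ r in Ioo (0 : ℝ) 1, ENNReal.ofReal (r ^ (n - 1)) *
          ENNReal.ofReal (r ^ (-(n : ℝ)) * X1 a r ^ (2 * ((n : ℝ) - 1) / (n - 2)) *
            |v (r • ω)| ^ (2 * (n : ℝ) / (n - 2))) := by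
  have hN : (3 : ℝ) ≤ n := by exact_mod_cast hn
  have hN2 : 0 < (n : ℝ) - 2 := by linarith
  rw [← lintegral_comp_logRadius ha fun r => ENNReal.ofReal (r ^ (n - 1)) *
    ENNReal.ofReal (r ^ (-(n : ℝ)) * X1 a r ^ (2 * ((n : ℝ) - 1) / (n - 2)) *
      |v (r • ω)| ^ (2 * (n : ℝ) / (n - 2))),
    ← lintegral_const_mul' _ _ ENNReal.ofReal_ne_top]
  refine setLIntegral_congr_fun measurableSet_Ioo fun ρ hρ => ?_
  have hρ0 := hρ.1
  have hr := logRadius_pos a ρ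
  rw [← ENNReal.ofReal_mul (by positivity), ← ENNReal.ofReal_mul (by positivity),
    ← ENNReal.ofReal_mul (by positivity), ← ENNReal.ofReal_mul (by positivity)]
  congr 1
  rw [logSubst_smul hω hρ0, X1_logRadius hρ0, abs_mul, abs_of_pos (rpow_pos_of_pos hρ0 β),
    mul_rpow (by positivity) (abs_nonneg _), div_rpow (by positivity) ha.le, ← rpow_mul hρ0.le,
    ← rpow_mul hρ0.le]
  have e1 : logRadius a ρ ^ (n - 1) * logRadius a ρ ^ (-(n : ℝ)) * logRadius a ρ = 1 := by
    rw [← rpow_natCast, ← rpow_add hr, ← rpow_add_one hr.ne', Nat.cast_sub (by omega)]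
    push_cast
    rw [show (n : ℝ) - 1 + -n + 1 = 0 by ring, rpow_zero]
  have e2 : ρ ^ (n - 1) * ρ ^ (β * (2 * (n : ℝ) / (n - 2))) =
      ρ ^ (-1 / a - 1) * ρ ^ (1 / a * (2 * ((n : ℝ) - 1) / (n - 2))) := by
    rw [← rpow_natCast, ← rpow_add hρ0, ← rpow_add hρ0, Nat.cast_sub (by omega)]
    congr 1
    rw [neg_div, ← hβa]
    push_cast
    field_simp
    ring
  have ha' := (rpow_pos_of_pos ha (2 * ((n : ℝ) - 1) / (n - 2))).ne'
  rw [← mul_assoc, e2]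
  set P := |v (logRadius a ρ • ω)| ^ (2 * (n : ℝ) / (n - 2))
  set A := a ^ (2 * ((n : ℝ) - 1) / (n - 2))
  set R := ρ ^ (1 / a * (2 * ((n : ℝ) - 1) / (n - 2)))
  calc ρ ^ (-1 / a - 1) * R * P
      = (logRadius a ρ ^ (n - 1) * logRadius a ρ ^ (-(n : ℝ)) * logRadius a ρ) *
        (ρ ^ (-1 / a - 1) * R * P) * (A / A) := by rw [e1, div_self ha']; ring
    _ = _ := by ring

end

lemma setLIntegral_ball_eq_lintegral_toSphere {n : ℕ} (hn : 1 ≤ n)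
    {g : EuclideanSpace ℝ (Fin n) → ENNReal} (hg : Measurable g) :
    ∫⁻ x in Metric.ball 0 1, g x = ∫⁻ ω, (∫⁻ r in Ioo (0 : ℝ) 1,
      ENNReal.ofReal (r ^ (n - 1)) * g (r • (ω : EuclideanSpace ℝ (Fin n))))
        ∂(volume : Measure (EuclideanSpace ℝ (Fin n))).toSphere := by
  rw [← lintegral_indicator Metric.isOpen_ball.measurableSet,
    lintegral_eq_lintegral_toSphere hn (hg.indicator Metric.isOpen_ball.measurableSet)
      fun x hx => indicator_of_notMem (by simpa using hx) _]
  refine lintegral_congr fun ω => setLIntegral_congr_fun measurableSet_Ioo fun r hr => ?_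
  have : r • (ω : EuclideanSpace ℝ (Fin n)) ∈ Metric.ball 0 1 := by
    simpa [norm_smul, abs_of_pos hr.1] using hr.2
  rw [indicator_of_mem this]

end

theorem stmt8 (n : ℕ) (hn : 3 ≤ n) (a : ℝ) (ha0 : 0 < a)
    (ha : a < 1 / ((n : ℝ) - 2))
    (v : EuclideanSpace ℝ (Fin n) → ℝ) (hu : ContDiff ℝ (⊤ : ℕ∞) v)
    (hcs : HasCompactSupport v)
    (hsupp : tsupport v ⊆ Metric.ball (0 : EuclideanSpace ℝ (Fin n)) 1) :
    (∫ x in Metric.ball (0 : EuclideanSpace ℝ (Fin n)) 1, ‖x‖ ^ (-((n : ℝ) - 2)) * ‖gradient v x‖ ^ 2)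
      ≥ a ^ (2 * ((n : ℝ) - 1) / (n : ℝ)) * sobolevConst n *
          (∫ x in Metric.ball (0 : EuclideanSpace ℝ (Fin n)) 1,
              ‖x‖ ^ (-(n : ℝ)) * (X1 a ‖x‖) ^ (2 * ((n : ℝ) - 1) / ((n : ℝ) - 2)) *
                |v x| ^ (2 * (n : ℝ) / ((n : ℝ) - 2)))
            ^ (((n : ℝ) - 2) / (n : ℝ)) := by
  have hN : (3 : ℝ) ≤ n := by exact_mod_cast hn
  have hN2 : 0 < (n : ℝ) - 2 := by linarith
  have hC1 : ContDiff ℝ 1 v := hu.of_le (by exact_mod_cast le_top)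
  have hvd : Differentiable ℝ v := hC1.differentiable one_ne_zero
  have hnot : ∀ x : EuclideanSpace ℝ (Fin n), 1 ≤ ‖x‖ → x ∉ tsupport v := fun x hx hx' =>
    absurd (hsupp hx') (by simpa using hx)
  have hv0 : ∀ x, 1 ≤ ‖x‖ → v x = 0 := fun x hx => image_eq_zero_of_notMem_tsupport (hnot x hx)
  have hv1 : ∀ x, 1 ≤ ‖x‖ → gradient v x = 0 := fun x hx => by
    rw [← norm_eq_zero, norm_gradient, norm_eq_zero]
    exact image_eq_zero_of_notMem_tsupport fun h => hnot x hx (tsupport_fderiv_subset ℝ h)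
  set β : ℝ := 1 / (2 * a) - ((n : ℝ) - 2) / 2 with hβ
  have hβ0 : 0 < β := by
    have h1 : (n : ℝ) - 2 < 1 / a := by
      rw [lt_div_iff₀ hN2] at ha
      rw [lt_div_iff₀ ha0]
      linarith
    have h2 : 1 / (2 * a) = 1 / a / 2 := by field_simp
    rw [hβ, h2]
    linarith
  have hβa : (n : ℝ) - 2 + 2 * β = 1 / a := by rw [hβ]; field_simp; ring
  set w := logSubst a β v
  have hwc : Continuous w := continuous_logSubst ha0 hβ0 hvd hcs
  set p : ℝ := 2 * (n : ℝ) / ((n : ℝ) - 2) with hp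
  set q : ℝ := 2 * ((n : ℝ) - 1) / ((n : ℝ) - 2) with hq
  have hp0 : 0 < p := by positivity
  have hgm : ∀ f : EuclideanSpace ℝ (Fin n) → ℝ, Measurable fun x => ‖gradient f x‖ := fun f => by
    simp_rw [norm_gradient]
    exact (measurable_fderiv ℝ f).norm
  -- the mass
  have hmass : ∫ x, |w x| ^ p = a ^ q *
      ∫ x in Metric.ball (0 : EuclideanSpace ℝ (Fin n)) 1, ‖x‖ ^ (-(n : ℝ)) * X1 a ‖x‖ ^ q * |v x| ^ p := by
    have hX : Measurable fun x : EuclideanSpace ℝ (Fin n) =>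
        ‖x‖ ^ (-(n : ℝ)) * X1 a ‖x‖ ^ q * |v x| ^ p := by
      have h1 : Measurable fun x : EuclideanSpace ℝ (Fin n) => X1 a ‖x‖ :=
        (measurable_const.sub (measurable_log.comp measurable_norm)).inv
      exact ((measurable_norm.pow_const _).mul (h1.pow_const _)).mul
        (hvd.continuous.abs.measurable.pow_const _)
    rw [integral_eq_lintegral_of_nonneg_ae (Filter.Eventually.of_forall fun x => by positivity)
        (hwc.abs.measurable.pow_const p).aestronglyMeasurable,
      integral_eq_lintegral_of_nonneg_ae _ hX.aestronglyMeasurable,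
      ← ENNReal.toReal_ofReal (show 0 ≤ a ^ q by positivity), ← ENNReal.toReal_mul]
    · congr 1
      rw [lintegral_eq_lintegral_toSphere (by omega)
          (hwc.abs.measurable.pow_const p).ennreal_ofReal fun x hx => by
            simp [w, logSubst_eq_zero ha0 hv0 hx, hp0.ne'],
        setLIntegral_ball_eq_lintegral_toSphere (by omega) hX.ennreal_ofReal,
        ← lintegral_const_mul' _ _ ENNReal.ofReal_ne_top]
      refine lintegral_congr fun ω => ?_
      have hω : ‖(ω : EuclideanSpace ℝ (Fin n))‖ = 1 := by simp
      rw [lintegral_logSubst_rpow hn ha0 hβa hω]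
      congr 1
      refine setLIntegral_congr_fun measurableSet_Ioo fun r hr => ?_
      rw [norm_smul, hω, mul_one, norm_of_nonneg hr.1.le]
    · refine (ae_restrict_iff' Metric.isOpen_ball.measurableSet).2 (Filter.Eventually.of_forall fun x hx => ?_)
      have h1 : ‖x‖ < 1 := by simpa using hx
      have h2 : 0 ≤ X1 a ‖x‖ := by
        have := log_nonpos (norm_nonneg x) h1.le
        exact inv_nonneg.2 (by linarith)
      simp only [Pi.zero_apply]
      positivity
  -- the energy
  have hEm : Measurable fun x : EuclideanSpace ℝ (Fin n) =>
      ‖x‖ ^ (-((n : ℝ) - 2)) * ‖gradient v x‖ ^ 2 :=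
    (measurable_norm.pow_const _).mul ((hgm v).pow_const 2)
  set J := ∫⁻ x in Metric.ball (0 : EuclideanSpace ℝ (Fin n)) 1,
    ENNReal.ofReal (‖x‖ ^ (-((n : ℝ) - 2)) * ‖gradient v x‖ ^ 2) with hJ
  have hJpolar : J = ∫⁻ ω, (∫⁻ r in Set.Ioo (0 : ℝ) 1,
      ENNReal.ofReal (r * ‖gradient v (r • (ω : EuclideanSpace ℝ (Fin n)))‖ ^ 2))
        ∂(volume : Measure (EuclideanSpace ℝ (Fin n))).toSphere := by
    rw [hJ, setLIntegral_ball_eq_lintegral_toSphere (by omega) hEm.ennreal_ofReal]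
    refine lintegral_congr fun ω => setLIntegral_congr_fun measurableSet_Ioo fun r hr => ?_
    have hω : ‖(ω : EuclideanSpace ℝ (Fin n))‖ = 1 := by simp
    rw [← ENNReal.ofReal_mul (pow_nonneg hr.1.le _), norm_smul, hω, mul_one,
      norm_of_nonneg hr.1.le, ← mul_assoc, ← rpow_natCast, ← rpow_add hr.1,
      Nat.cast_sub (by omega)]
    push_cast
    rw [show (n : ℝ) - 1 + -(n - 2) = 1 by ring, rpow_one]
  have hJfin : J < ⊤ := by
    obtain ⟨C, hC⟩ := (hcs.fderiv ℝ).exists_bound_of_continuous (hC1.continuous_fderiv one_ne_zero)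
    rw [hJpolar]
    calc _ ≤ ∫⁻ _ : Metric.sphere (0 : EuclideanSpace ℝ (Fin n)) 1, ENNReal.ofReal (C ^ 2)
          ∂(volume : Measure (EuclideanSpace ℝ (Fin n))).toSphere := by
          refine lintegral_mono fun ω => ?_
          calc _ ≤ ∫⁻ _ in Set.Ioo (0 : ℝ) 1, ENNReal.ofReal (C ^ 2) := by
                refine setLIntegral_mono' measurableSet_Ioo fun r hr => ENNReal.ofReal_le_ofReal ?_
                rw [norm_gradient]
                have h1 := pow_le_pow_left₀ (norm_nonneg _)
                  (hC (r • (ω : EuclideanSpace ℝ (Fin n)))) 2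
                have h2 := sq_nonneg ‖fderiv ℝ v (r • (ω : EuclideanSpace ℝ (Fin n)))‖
                nlinarith [hr.1, hr.2]
            _ = _ := by simp
      _ < ⊤ := by
        rw [lintegral_const]
        exact ENNReal.mul_lt_top ENNReal.ofReal_lt_top (measure_lt_top _ _)
  have hwJ : ∫⁻ x, ENNReal.ofReal (‖fderiv ℝ w x‖ ^ 2) ≤ J := by
    simp_rw [← norm_gradient]
    rw [lintegral_eq_lintegral_toSphere (by omega) ((hgm w).pow_const 2).ennreal_ofReal
      fun x hx => by simp [w, gradient_logSubst_eq_zero ha0 hvd hv0 hv1 hx], hJpolar]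
    exact lintegral_mono fun ω => lintegral_pow_mul_norm_gradient_logSubst_le (by omega) ha0 hβ0.le
      hβa hC1 hv0 (by simp)
  have hwm : Measurable fun x => ‖fderiv ℝ w x‖ ^ 2 := (measurable_fderiv ℝ w).norm.pow_const 2
  have hwint : Integrable fun x => ‖fderiv ℝ w x‖ ^ 2 := by
    refine ⟨hwm.aestronglyMeasurable, ?_⟩
    rw [hasFiniteIntegral_iff_ofReal (Filter.Eventually.of_forall fun x => by positivity)]
    exact hwJ.trans_lt hJfin
  have hS := sobolev_of_hasCompactSupport hn hwc (hasCompactSupport_logSubst ha0 hv0)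
    (fun x hx => differentiableAt_logSubst ha0 hvd hx) hwint
  have hE : ∫ x, ‖fderiv ℝ w x‖ ^ 2 ≤ ∫ x in Metric.ball (0 : EuclideanSpace ℝ (Fin n)) 1,
      ‖x‖ ^ (-((n : ℝ) - 2)) * ‖gradient v x‖ ^ 2 := by
    rw [integral_eq_lintegral_of_nonneg_ae (Filter.Eventually.of_forall fun x => by positivity)
        hwm.aestronglyMeasurable,
      integral_eq_lintegral_of_nonneg_ae (Filter.Eventually.of_forall fun x => by positivity)
        hEm.aestronglyMeasurable]
    exact ENNReal.toReal_mono hJfin.ne hwJ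
  refine le_trans (le_of_eq ?_) (hS.trans hE)
  rw [← hp, hmass, mul_rpow (by positivity), ← rpow_mul ha0.le,
    show q * (((n : ℝ) - 2) / n) = 2 * ((n : ℝ) - 1) / n by rw [hq]; field_simp]
  · ring
  · refine setIntegral_nonneg Metric.isOpen_ball.measurableSet fun x hx => ?_
    have h1 : ‖x‖ < 1 := by simpa using hx
    have h2 : 0 ≤ X1 a ‖x‖ := by
      have := log_nonpos (norm_nonneg x) h1.le
      exact inv_nonneg.2 (by linarith)
    positivity
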